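/- arXiv:1110.0090 — 2 statements merged into one kernel-verified Lean document; each statement's English description precedes it below -/
import Mathlib

section
/- Let X be a beta random variable with density (Γ(α+β)/(Γ(α)Γ(β))) x^{α−1}(1−x)^{β−1} on (0, 1), where α, β > 0. Let m, n be nonnegative integers with n ≥ 1, ℓ = max{m, n}, and let g : (0, 1) → ℝ be (ℓ−1)-times continuously differentiable with g^{(ℓ−1)} absolutely continuous on (0, 1) (a.e. derivative g^{(ℓ)}), E[X^n(1−X)^n (g^{(n)}(X))²] < ∞, and E[X^i(1−X)^i |g^{(i)}(X)|] < ∞ for i = n+1, …, m. Define S_{m,n}(g) = Σ_{i=1}^{m} (C(m,i) [α+β+m+i]_n [α+β]_{2i} / ((m+n)_i [α]_i [β]_i [α+β+i−1]_i [α+β+m]_n))(E[X^i(1−X)^i g^{(i)}(X)])² + Σ_{i=1}^{n} (−1)^{i−1}(C(n,i)/((m+n)_i [α+β+m]_i)) E[X^i(1−X)^i (g^{(i)}(X))²]. Then (−1)^n (Var[g(X)] − S_{m,n}(g)) ≥ 0, with equality if and only if g is a polynomial of degree at most m+n on (0, 1). -/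
open MeasureTheory ProbabilityTheory Finset Filter

noncomputable section

/-- Falling factorial `(x)_k = x (x-1) ⋯ (x-k+1)`, with `(x)_0 = 1`. -/
def fall (x : ℝ) (k : ℕ) : ℝ := ∏ j ∈ Finset.range k, (x - j)

/-- Rising factorial `[x]_k = x (x+1) ⋯ (x+k-1)`, with `[x]_0 = 1`. -/
def rise (x : ℝ) (k : ℕ) : ℝ := ∏ j ∈ Finset.range k, (x + j)

/-- The product `∏_{j=a}^{a+len-1} (1 - j δ)` of `len` consecutive factors
(an empty product is `1`). -/
def pp (δ a : ℝ) (len : ℕ) : ℝ := ∏ j ∈ Finset.range len, (1 - (a + j) * δ)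

/-- The open real interval with (possibly infinite) endpoints `α ω : EReal`. -/
def erealIoo (α ω : EReal) : Set ℝ := {x : ℝ | α < (x : EReal) ∧ (x : EReal) < ω}

/-- `g` coincides on `J` with a polynomial of degree at most `d`. -/
def IsPolyOn (g : ℝ → ℝ) (J : Set ℝ) (d : ℕ) : Prop :=
  ∃ p : Polynomial ℝ, p.natDegree ≤ d ∧ ∀ x ∈ J, g x = p.eval x

/-- The quadratic `q(x) = δ x² + β x + γ` of a Pearson family. -/
def pq (δ β γ : ℝ) : ℝ → ℝ := fun x => δ * x ^ 2 + β * x + γ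

/-- `P` is the distribution of a random variable with density `f` (w.r.t. Lebesgue
measure) belonging to the integrated Pearson family `IP(μ; δ, β, γ)`:
`μ` is the (finite) mean of `P`, `|δ|+|β|+|γ| > 0`, and
`∫_{-∞}^x (μ - t) f(t) dt = q(x) f(x)` for all `x`. -/
def IsIntegratedPearson (P : Measure ℝ) (f : ℝ → ℝ) (μ δ β γ : ℝ) : Prop :=
  IsProbabilityMeasure P ∧
  (∀ x, 0 ≤ f x) ∧
  P = volume.withDensity (fun x => ENNReal.ofReal (f x)) ∧
  Integrable (fun x : ℝ => x) P ∧
  μ = ∫ x, x ∂P ∧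
  0 < |δ| + |β| + |γ| ∧
  ∀ x : ℝ, (∫ t in Set.Iic x, (μ - t) * f t) = pq δ β γ x * f x

/-- Membership in the class `H^{m,n}(X)` for the distribution `P` of `X` with Pearson
quadratic `q` and support `J`.  Here `gd k` plays the role of the `k`-th derivative
`g^{(k)}` of `g = gd 0` on `J`.  With `ℓ = max m n`:  `g ∈ C^{ℓ-1}(J)`
(encoded by `gd k` having derivative `gd (k+1)` at every point of `J` for `k+1 < ℓ`,
and `gd (ℓ-1)` continuous on `J`), `g^{(ℓ-1)}` is absolutely continuous on `J` with
a.e. derivative `g^{(ℓ)} = gd ℓ` (encoded by the fundamental theorem of calculus: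
`gd ℓ` is locally integrable and `gd (ℓ-1)` is its integral on every subinterval of `J`),
and the moment conditions `E[q(X)^n (g^{(n)}(X))²] < ∞` and
`E[q(X)^i |g^{(i)}(X)|] < ∞` for `n < i ≤ m` hold. -/
def MemH (P : Measure ℝ) (q : ℝ → ℝ) (J : Set ℝ) (m n : ℕ) (gd : ℕ → ℝ → ℝ) : Prop :=
  (∀ k, k + 1 < max m n → ∀ x ∈ J, HasDerivAt (gd k) (gd (k + 1) x) x) ∧
  (1 ≤ max m n → ContinuousOn (gd (max m n - 1)) J) ∧
  (1 ≤ max m n → ∀ a ∈ J, ∀ b ∈ J,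
    IntervalIntegrable (gd (max m n)) volume a b ∧
      gd (max m n - 1) b - gd (max m n - 1) a = ∫ t in a..b, gd (max m n) t) ∧
  Integrable (fun x => q x ^ n * (gd n x) ^ 2) P ∧
  ∀ i, n < i → i ≤ m → Integrable (fun x => q x ^ i * |gd i x|) P

/-- The variance bound `S_{m,n}(g)` of Theorem 2.1, for a Pearson distribution `P`
with quadratic `q` and parameter `δ`. -/
def Sbound (P : Measure ℝ) (δ : ℝ) (q : ℝ → ℝ) (m n : ℕ) (gd : ℕ → ℝ → ℝ) : ℝ :=
  (∑ i ∈ Finset.Icc 1 m,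
      ((m.choose i : ℝ) * pp δ ((m : ℝ) + i) n /
          (fall ((m : ℝ) + n) i * (∫ x, q x ^ i ∂P) * pp δ ((i : ℝ) - 1) i *
            pp δ (m : ℝ) n)) *
        (∫ x, q x ^ i * gd i x ∂P) ^ 2) +
    ∑ i ∈ Finset.Icc 1 n,
      (-1 : ℝ) ^ (i - 1) *
          ((n.choose i : ℝ) / (fall ((m : ℝ) + n) i * pp δ (m : ℝ) i)) *
        ∫ x, q x ^ i * (gd i x) ^ 2 ∂P

/-- The density of the beta distribution with parameters `a, b > 0`. -/
def betaDensity (a b : ℝ) : ℝ → ℝ := fun x =>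
  if x ∈ Set.Ioo (0 : ℝ) 1 then
    Real.Gamma (a + b) / (Real.Gamma a * Real.Gamma b) * x ^ (a - 1) * (1 - x) ^ (b - 1)
  else 0

/-- The bound `S_{m,n}(g)` specialized to the beta distribution:
`S_{m,n}(g) = Σ_{i=1}^{m} (C(m,i) [α+β+m+i]_n [α+β]_{2i}
    / ((m+n)_i [α]_i [β]_i [α+β+i−1]_i [α+β+m]_n)) (E X^i(1−X)^i g^{(i)}(X))²
  + Σ_{i=1}^{n} (−1)^{i−1}(C(n,i)/((m+n)_i [α+β+m]_i)) E X^i(1−X)^i (g^{(i)}(X))²`. -/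
def SbetaBound (P : Measure ℝ) (a b : ℝ) (m n : ℕ) (gd : ℕ → ℝ → ℝ) : ℝ :=
  (∑ i ∈ Finset.Icc 1 m,
      ((m.choose i : ℝ) * rise (a + b + m + i) n * rise (a + b) (2 * i) /
          (fall ((m : ℝ) + n) i * rise a i * rise b i * rise (a + b + i - 1) i *
            rise (a + b + m) n)) *
        (∫ x, x ^ i * (1 - x) ^ i * gd i x ∂P) ^ 2) +
    ∑ i ∈ Finset.Icc 1 n,
      (-1 : ℝ) ^ (i - 1) *
          ((n.choose i : ℝ) / (fall ((m : ℝ) + n) i * rise (a + b + m) i)) *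
        ∫ x, x ^ i * (1 - x) ^ i * (gd i x) ^ 2 ∂P


/-- the unnormalized beta weight -/
def wt (A B x : ℝ) : ℝ := x ^ (A - 1) * (1 - x) ^ (B - 1)

/-- Lebesgue measure on `(0,1)` -/
def lam : Measure ℝ := volume.restrict (Set.Ioo (0 : ℝ) 1)

instance : IsFiniteMeasure lam := by unfold lam; infer_instance

lemma ae_lam {p : ℝ → Prop} (h : ∀ x ∈ Set.Ioo (0 : ℝ) 1, p x) : ∀ᵐ x ∂lam, p x :=
  ae_restrict_of_forall_mem measurableSet_Ioo h

lemma wt_pos (A B : ℝ) {x : ℝ} (hx : x ∈ Set.Ioo (0 : ℝ) 1) : 0 < wt A B x :=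
  mul_pos (Real.rpow_pos_of_pos hx.1 _) (Real.rpow_pos_of_pos (by linarith [hx.2]) _)

lemma wt_meas (A B : ℝ) : Measurable (wt A B) := by unfold wt; fun_prop

lemma wt_succ (A B : ℝ) {x : ℝ} (hx : x ∈ Set.Ioo (0 : ℝ) 1) :
    wt (A + 1) (B + 1) x = x * (1 - x) * wt A B x := by
  have h1 : (1 : ℝ) - x ≠ 0 := by linarith [hx.2]
  unfold wt
  rw [show A + 1 - 1 = (A - 1) + 1 by ring, show B + 1 - 1 = (B - 1) + 1 by ring,
    Real.rpow_add_one hx.1.ne', Real.rpow_add_one h1]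
  ring

lemma wt_refl (A B x : ℝ) : wt A B (1 - x) = wt B A x := by
  unfold wt; rw [sub_sub_cancel, mul_comm]

lemma wt_intervalIntegrable {A B : ℝ} (hA : 0 < A) (hB : 0 < B) :
    IntervalIntegrable (wt A B) volume 0 1 := by
  have h := (Complex.betaIntegral_convergent (u := A) (v := B) (by simpa) (by simpa)).norm
  refine h.congr_ae ?_
  rw [Set.uIoc_of_le zero_le_one]
  have : ∀ᵐ x : ℝ, x ≠ 1 := by simp [ae_iff, measure_singleton]
  filter_upwards [ae_restrict_mem measurableSet_Ioc, ae_restrict_of_ae this] with x hx hx1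
  have h1 : x < 1 := lt_of_le_of_ne hx.2 hx1
  rw [norm_mul, Complex.norm_cpow_eq_rpow_re_of_pos hx.1,
    show (1 : ℂ) - (x : ℂ) = ((1 - x : ℝ) : ℂ) by push_cast; ring,
    Complex.norm_cpow_eq_rpow_re_of_pos (by linarith)]
  simp [wt]

lemma wt_integrable {A B : ℝ} (hA : 0 < A) (hB : 0 < B) : Integrable (wt A B) lam := by
  have h := wt_intervalIntegrable hA hB
  rw [intervalIntegrable_iff_integrableOn_Ioo_of_le zero_le_one] at h
  exact h

/-- tail bound at `0` -/
lemma tail0 {A B : ℝ} (hA : 0 < A) (hB : 0 < B) {t : ℝ} (ht : 0 < t) (ht2 : t ≤ 1 / 2) :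
    ∫ x in (0 : ℝ)..t, wt A B x ≤ 2 * 2 ^ B / A * wt (A + 1) (B + 1) t := by
  have h1 : ∫ x in (0 : ℝ)..t, wt A B x ≤ ∫ x in (0 : ℝ)..t, 2 * x ^ (A - 1) := by
    apply intervalIntegral.integral_mono_on_of_le_Ioo ht.le
    · exact (wt_intervalIntegrable hA hB).mono_set (by
        rw [Set.uIcc_of_le ht.le, Set.uIcc_of_le zero_le_one]
        exact Set.Icc_subset_Icc le_rfl (by linarith))
    · exact (intervalIntegral.intervalIntegrable_rpow' (by linarith)).const_mul 2
    · intro x hx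
      have hx0 : 0 < 1 - x := by linarith [hx.2]
      have h2 : (1 - x) ^ (B - 1) ≤ 2 := by
        rw [Real.rpow_sub_one hx0.ne', div_le_iff₀ hx0]
        have := Real.rpow_le_one hx0.le (by linarith [hx.1]) hB.le
        linarith [hx.2]
      unfold wt
      have := Real.rpow_pos_of_pos hx.1 (A - 1)
      nlinarith
  refine h1.trans ?_
  rw [intervalIntegral.integral_const_mul, integral_rpow (Or.inl (by linarith))]
  unfold wt
  simp only [sub_add_cancel, add_sub_cancel_right]
  rw [Real.zero_rpow hA.ne', sub_zero]
  have h3 : 1 ≤ (2 : ℝ) ^ B * (1 - t) ^ B := by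
    rw [← Real.mul_rpow (by norm_num) (by linarith)]
    exact Real.one_le_rpow (by linarith) hB.le
  have h4 : 0 < t ^ A := Real.rpow_pos_of_pos ht _
  calc 2 * (t ^ A / A) = 2 / A * t ^ A * 1 := by ring
    _ ≤ 2 / A * t ^ A * (2 ^ B * (1 - t) ^ B) := by gcongr
    _ = _ := by ring

lemma tail1 {A B : ℝ} (hA : 0 < A) (hB : 0 < B) {t : ℝ} (ht : t < 1) (ht2 : 1 / 2 ≤ t) :
    ∫ x in t..(1 : ℝ), wt A B x ≤ 2 * 2 ^ A / B * wt (A + 1) (B + 1) t := by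
  have h := tail0 hB hA (t := 1 - t) (by linarith) (by linarith)
  rw [wt_refl] at h
  convert h using 1
  have := intervalIntegral.integral_comp_sub_left (a := t) (b := 1) (fun x => wt B A x) 1
  simp only [wt_refl, sub_self] at this
  exact this

/-- absolute continuity on the unit interval, with given derivative -/
def Pair (h h' : ℝ → ℝ) : Prop := ∀ x ∈ Set.Ioo (0 : ℝ) 1, ∀ y ∈ Set.Ioo (0 : ℝ) 1,
  IntervalIntegrable h' volume x y ∧ h y - h x = ∫ t in x..y, h' t

lemma Pair.aesm {h h' : ℝ → ℝ} (H : Pair h h') : AEStronglyMeasurable h' lam := by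
  have hU : Set.Ioo (0 : ℝ) 1 = ⋃ j : ℕ, Set.Ioc (1 / ((j : ℝ) + 2)) (1 - 1 / ((j : ℝ) + 2)) := by
    ext x
    simp only [Set.mem_Ioo, Set.mem_iUnion, Set.mem_Ioc]
    constructor
    · rintro ⟨h0, h1⟩
      obtain ⟨j, hj⟩ := exists_nat_one_div_lt (lt_min h0 (sub_pos.2 h1))
      have h2 : 1 / ((j : ℝ) + 2) ≤ 1 / ((j : ℝ) + 1) := by gcongr; norm_num
      have h3 := lt_of_le_of_lt h2 hj
      exact ⟨j, h3.trans_le (min_le_left _ _), by linarith [h3.trans_le (min_le_right x (1-x))]⟩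
    · rintro ⟨j, h0, h1⟩
      have : 0 < 1 / ((j : ℝ) + 2) := by positivity
      constructor <;> linarith
  unfold lam
  rw [hU, aestronglyMeasurable_iUnion_iff]
  intro j
  have h0 : 0 < 1 / ((j : ℝ) + 2) := by positivity
  have h1 : 1 / ((j : ℝ) + 2) ≤ 1 / 2 := by gcongr; linarith [(Nat.cast_nonneg j : (0:ℝ) ≤ j)]
  exact (H _ ⟨h0, by linarith⟩ (1 - 1 / ((j : ℝ) + 2)) ⟨by linarith, by linarith⟩).1.1.aestronglyMeasurable

lemma Pair.continuousOn {h h' : ℝ → ℝ} (H : Pair h h') : ContinuousOn h (Set.Ioo 0 1) := by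
  intro x hx
  have hx0 : 0 < x / 2 := by linarith [hx.1]
  have hx1 : (1 + x) / 2 < 1 := by linarith [hx.2]
  have ha : x / 2 ∈ Set.Ioo (0 : ℝ) 1 := ⟨hx0, by linarith [hx.2]⟩
  have hb : (1 + x) / 2 ∈ Set.Ioo (0 : ℝ) 1 := ⟨by linarith [hx.1], hx1⟩
  have hc := intervalIntegral.continuousOn_primitive_interval'
    (H _ ha _ hb).1 (Set.left_mem_uIcc)
  have hle : x / 2 ≤ (1 + x) / 2 := by linarith
  rw [Set.uIcc_of_le hle] at hc
  have hn : Set.Icc (x / 2) ((1 + x) / 2) ∈ nhds x :=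
    Icc_mem_nhds (by linarith [hx.1]) (by linarith [hx.2])
  have hcx := (hc.continuousAt hn).add_const (h (x / 2))
  refine (hcx.congr ?_).continuousWithinAt
  filter_upwards [isOpen_Ioo.mem_nhds hx] with y hy
  rw [← (H _ ha y hy).2]; ring

lemma Pair.of_deriv {h h' : ℝ → ℝ} (hd : ∀ x ∈ Set.Ioo (0 : ℝ) 1, HasDerivAt h (h' x) x)
    (hc : ContinuousOn h' (Set.Ioo 0 1)) : Pair h h' := by
  intro x hx y hy
  have hs : Set.uIcc x y ⊆ Set.Ioo 0 1 := Set.OrdConnected.uIcc_subset Set.ordConnected_Ioo hx hy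
  have hi : IntervalIntegrable h' volume x y := (hc.mono hs).intervalIntegrable
  exact ⟨hi, (intervalIntegral.integral_eq_sub_of_hasDerivAt (fun t ht => hd t (hs ht)) hi).symm⟩

lemma aesm_of_cont {h : ℝ → ℝ} (hc : ContinuousOn h (Set.Ioo 0 1)) : AEStronglyMeasurable h lam :=
  hc.aestronglyMeasurable measurableSet_Ioo

/-- determinacy -/
lemma determinacy {f : ℝ → ℝ} (hf : Integrable f lam)
    (h : ∀ p : Polynomial ℝ, ∫ x, f x * p.eval x ∂lam = 0) : f =ᵐ[lam] 0 := by
  have key : ∀ g : ℝ → ℝ, Continuous g → ∫ x, f x * g x ∂lam = 0 := by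
    intro g hg
    by_contra hne
    have hpos : 0 < |∫ x, f x * g x ∂lam| := abs_pos.2 hne
    set K := ∫ x, |f x| ∂lam with hK
    have hK0 : 0 ≤ K := integral_nonneg fun x => abs_nonneg _
    obtain ⟨p, hp⟩ := exists_polynomial_near_of_continuousOn 0 1 g hg.continuousOn
      (|∫ x, f x * g x ∂lam| / (K + 1)) (by positivity)
    have bd : ∀ u : ℝ → ℝ, Continuous u → Integrable (fun x => f x * u x) lam := by
      intro u hu
      obtain ⟨C, hC⟩ := (isCompact_Icc (a := (0:ℝ)) (b := 1)).exists_bound_of_continuousOn hu.continuousOn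
      exact hf.mul_bdd (c := C) hu.aestronglyMeasurable
        (ae_lam fun x hx => hC x (Set.Ioo_subset_Icc_self hx))
    have h1 : ∫ x, f x * g x ∂lam = ∫ x, f x * (g x - p.eval x) ∂lam := by
      simp_rw [mul_sub]
      rw [integral_sub (bd _ hg) (bd _ p.continuous), h p, sub_zero]
    have h2 : |∫ x, f x * (g x - p.eval x) ∂lam| ≤
        ∫ x, |f x| * (|∫ x, f x * g x ∂lam| / (K + 1)) ∂lam := by
      refine (abs_integral_le_integral_abs).trans (integral_mono_ae
        (bd _ (hg.sub p.continuous)).abs (hf.abs.mul_const _) (ae_lam fun x hx => ?_))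
      simp only [abs_mul]
      gcongr
      rw [abs_sub_comm]
      exact (hp x (Set.Ioo_subset_Icc_self hx)).le
    rw [integral_mul_const, ← hK, ← h1] at h2
    have h3 : K * (|∫ x, f x * g x ∂lam| / (K + 1)) < |∫ x, f x * g x ∂lam| := by
      rw [mul_div_assoc', div_lt_iff₀ (by linarith)]
      nlinarith
    linarith
  apply ae_eq_zero_of_integral_contDiff_smul_eq_zero hf.locallyIntegrable
  intro g hg _
  simpa [mul_comm] using key g hg.continuous


/-- the kernel of the primitive based at `1/2` -/
def kern (x t : ℝ) : ℝ :=
  (if 1 / 2 < t ∧ t ≤ x then 1 else 0) - (if x < t ∧ t ≤ 1 / 2 then 1 else 0)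

lemma kern_meas : Measurable (fun p : ℝ × ℝ => kern p.1 p.2) := by
  unfold kern
  refine Measurable.sub (Measurable.ite ?_ measurable_const measurable_const)
    (Measurable.ite ?_ measurable_const measurable_const)
  · exact (measurableSet_lt measurable_const measurable_snd).inter
      (measurableSet_le measurable_snd measurable_fst)
  · exact (measurableSet_lt measurable_fst measurable_snd).inter
      (measurableSet_le measurable_snd measurable_const)

lemma kern_abs_le (x t : ℝ) : |kern x t| ≤ 1 := by
  unfold kern; split_ifs <;> norm_num

lemma integral_lam_eq (f : ℝ → ℝ) : ∫ x, f x ∂lam = ∫ x in (0:ℝ)..1, f x := by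
  rw [intervalIntegral.integral_of_le zero_le_one, integral_Ioc_eq_integral_Ioo]; rfl

lemma kern_right {f : ℝ → ℝ} {t : ℝ} (ht : t ∈ Set.Ioo (0:ℝ) 1) :
    ∫ x, f x * (if t ≤ x then 1 else 0) ∂lam = ∫ x in t..1, f x := by
  have : (fun x => f x * (if t ≤ x then 1 else 0)) = (Set.Ici t).indicator f := by
    ext x; by_cases h : t ≤ x <;> simp [h]
  rw [this, integral_indicator measurableSet_Ici, intervalIntegral.integral_of_le ht.2.le,
    integral_Ioc_eq_integral_Ioo, ← integral_Ico_eq_integral_Ioo, lam,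
    Measure.restrict_restrict measurableSet_Ici]
  congr 2
  ext x; simp only [Set.mem_inter_iff, Set.mem_Ici, Set.mem_Ioo, Set.mem_Ico]
  exact ⟨fun h => ⟨h.1, h.2.2⟩, fun h => ⟨h.1, by linarith [ht.1], h.2⟩⟩

lemma kern_left {f : ℝ → ℝ} {t : ℝ} (ht : t ∈ Set.Ioo (0:ℝ) 1) :
    ∫ x, f x * (if x < t then 1 else 0) ∂lam = ∫ x in 0..t, f x := by
  have : (fun x => f x * (if x < t then 1 else 0)) = (Set.Iio t).indicator f := by
    ext x; by_cases h : x < t <;> simp [h]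
  rw [this, integral_indicator measurableSet_Iio, intervalIntegral.integral_of_le ht.1.le,
    integral_Ioc_eq_integral_Ioo, lam,
    Measure.restrict_restrict measurableSet_Iio]
  congr 2
  ext x; simp only [Set.mem_inter_iff, Set.mem_Iio, Set.mem_Ioo]
  exact ⟨fun h => ⟨h.2.1, h.1⟩, fun h => ⟨h.2, h.1, by linarith [ht.2]⟩⟩

lemma kern_of_gt {t : ℝ} (h : 1 / 2 < t) (x : ℝ) : kern x t = if t ≤ x then 1 else 0 := by
  unfold kern; simp only [h, not_le.2 h, true_and, and_false, if_false, sub_zero]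

lemma kern_of_le {t : ℝ} (h : t ≤ 1 / 2) (x : ℝ) : kern x t = - if x < t then 1 else 0 := by
  unfold kern; simp only [h, not_lt.2 h, false_and, and_true, if_false, zero_sub]

lemma fub {h h' : ℝ → ℝ} (H : Pair h h') {A B : ℝ} (hA : 0 < A) (hB : 0 < B)
    (hi : Integrable (fun t => h' t * wt (A + 1) (B + 1) t) lam) {φ : ℝ → ℝ}
    (hφm : AEStronglyMeasurable φ lam) {M : ℝ}
    (hφ : ∀ x ∈ Set.Ioo (0 : ℝ) 1, |φ x| ≤ M * wt A B x) :
    Integrable (fun x => φ x * (h x - h (1 / 2))) lam ∧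
    ∫ x, φ x * (h x - h (1 / 2)) ∂lam = ∫ t, h' t * (∫ x, φ x * kern x t ∂lam) ∂lam := by
  have hM : 0 ≤ M := by
    have h1 := hφ (1 / 2) ⟨by norm_num, by norm_num⟩
    have h2 := wt_pos A B (x := 1 / 2) ⟨by norm_num, by norm_num⟩
    by_contra hc
    have := abs_nonneg (φ (1 / 2))
    nlinarith
  have hφi : Integrable φ lam :=
    ((wt_integrable hA hB).const_mul M).mono' hφm (ae_lam fun x hx => hφ x hx)
  set F : ℝ × ℝ → ℝ := fun p => φ p.1 * kern p.1 p.2 * h' p.2 with hF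
  have hFm : AEStronglyMeasurable F (lam.prod lam) :=
    (hφm.comp_fst.mul kern_meas.aestronglyMeasurable).mul H.aesm.comp_snd
  have hcol : ∀ t, Integrable (fun x => φ x * kern x t) lam := fun t =>
    hφi.mul_bdd (c := 1) (kern_meas.comp (measurable_id.prodMk measurable_const)).aestronglyMeasurable
      (ae_of_all _ fun x => kern_abs_le x t)
  obtain ⟨K, hK⟩ : ∃ K : ℝ, ∀ t ∈ Set.Ioo (0 : ℝ) 1,
      ∫ x, |φ x * kern x t| ∂lam ≤ K * wt (A + 1) (B + 1) t := by
    refine ⟨M * max (2 * 2 ^ B / A) (2 * 2 ^ A / B), fun t ht => ?_⟩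
    have hw : Integrable (fun x => M * wt A B x * |kern x t|) lam :=
      ((wt_integrable hA hB).const_mul M).mul_bdd (c := 1)
        (kern_meas.comp (measurable_id.prodMk measurable_const)).abs.aestronglyMeasurable
        (ae_of_all _ fun x => by simpa using kern_abs_le x t)
    have h1 : ∫ x, |φ x * kern x t| ∂lam ≤ ∫ x, M * wt A B x * |kern x t| ∂lam := by
      refine integral_mono_ae (hcol t).abs hw (ae_lam fun x hx => ?_)
      simp only [abs_mul]
      gcongr
      exact hφ x hx
    refine h1.trans ?_
    have hwp := wt_pos (A + 1) (B + 1) ht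
    simp_rw [mul_assoc]
    rw [integral_const_mul]
    refine mul_le_mul_of_nonneg_left ?_ hM
    rcases lt_or_ge (1 / 2) t with h2 | h2
    · have : ∀ x, |kern x t| = if t ≤ x then 1 else 0 := fun x => by
        rw [kern_of_gt h2]; split_ifs <;> simp
      simp_rw [this]
      rw [kern_right ht]
      refine (tail1 hA hB ht.2 h2.le).trans ?_
      gcongr; exact le_max_right _ _
    · have : ∀ x, |kern x t| = if x < t then 1 else 0 := fun x => by
        rw [kern_of_le h2]; split_ifs <;> simp
      simp_rw [this]
      rw [kern_left ht]
      refine (tail0 hA hB ht.1 h2).trans ?_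
      gcongr; exact le_max_left _ _
  have hFi : Integrable F (lam.prod lam) := by
    rw [integrable_prod_iff' hFm]
    refine ⟨ae_of_all _ fun t => (hcol t).mul_const (h' t), ?_⟩
    refine (hi.abs.const_mul K).mono' ?_ (ae_lam fun t ht => ?_)
    · exact hFm.norm.prod_swap.integral_prod_right'
    · simp only [hF, norm_mul, Real.norm_eq_abs]
      rw [integral_mul_const, abs_of_nonneg
        (mul_nonneg (integral_nonneg fun x => by positivity) (abs_nonneg _))]
      have := hK t ht
      simp only [abs_mul] at this
      calc _ ≤ (K * wt (A + 1) (B + 1) t) * |h' t| := by gcongr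
        _ = _ := by rw [abs_mul, abs_of_pos (wt_pos (A + 1) (B + 1) ht)]; ring
  have hrow : ∀ x ∈ Set.Ioo (0 : ℝ) 1, ∫ t, F (x, t) ∂lam = φ x * (h x - h (1 / 2)) := by
    intro x hx
    have hh : (1 / 2 : ℝ) ∈ Set.Ioo (0 : ℝ) 1 := ⟨by norm_num, by norm_num⟩
    obtain ⟨hintg, heq⟩ := H _ hh x hx
    rw [heq, intervalIntegral]
    simp only [hF, mul_assoc]
    rw [integral_const_mul]
    congr 1
    have e1 : ∀ t, kern x t * h' t = (Set.Ioc (1 / 2) x).indicator h' t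
        - (Set.Ioc x (1 / 2)).indicator h' t := by
      intro t
      unfold kern
      simp only [Set.indicator, Set.mem_Ioc]
      split_ifs <;> ring
    simp_rw [e1]
    have s1 : Set.Ioc (1 / 2) x ∩ Set.Ioo 0 1 = Set.Ioc (1 / 2) x := by
      apply Set.inter_eq_left.2; intro y hy; exact ⟨by linarith [hy.1], by linarith [hy.2, hx.2]⟩
    have s2 : Set.Ioc x (1 / 2) ∩ Set.Ioo 0 1 = Set.Ioc x (1 / 2) := by
      apply Set.inter_eq_left.2; intro y hy; exact ⟨by linarith [hy.1, hx.1], by linarith [hy.2]⟩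
    rw [integral_sub, integral_indicator measurableSet_Ioc, integral_indicator measurableSet_Ioc,
      lam, Measure.restrict_restrict measurableSet_Ioc, Measure.restrict_restrict measurableSet_Ioc,
      s1, s2]
    · rw [integrable_indicator_iff measurableSet_Ioc, IntegrableOn, lam,
        Measure.restrict_restrict measurableSet_Ioc, s1]
      exact hintg.1
    · rw [integrable_indicator_iff measurableSet_Ioc, IntegrableOn, lam,
        Measure.restrict_restrict measurableSet_Ioc, s2]
      exact hintg.2
  have hrow' := ae_lam hrow
  refine ⟨(hFi.integral_prod_left).congr hrow', ?_⟩
  rw [← integral_congr_ae hrow', integral_integral_swap (f := fun x t => F (x, t)) hFi]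
  congr 1; ext t
  simp only [hF]
  rw [integral_mul_const, mul_comm]


lemma poly_bdd (u : Polynomial ℝ) : ∃ M, ∀ x ∈ Set.Ioo (0 : ℝ) 1, |u.eval x| ≤ M := by
  obtain ⟨C, hC⟩ := (isCompact_Icc (a := (0:ℝ)) (b := 1)).exists_bound_of_continuousOn
    u.continuous.continuousOn
  exact ⟨C, fun x hx => hC x (Set.Ioo_subset_Icc_self hx)⟩

lemma integrable_mul_poly {f : ℝ → ℝ} (hf : Integrable f lam) (u : Polynomial ℝ) :
    Integrable (fun x => f x * u.eval x) lam := by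
  obtain ⟨M, hM⟩ := poly_bdd u
  exact hf.mul_bdd (c := M) u.continuous.aestronglyMeasurable (ae_lam hM)

/-- The adjoint operator of `-d/dx`. -/
def TT (A B : ℝ) (u : Polynomial ℝ) : Polynomial ℝ :=
  Polynomial.X * (1 - Polynomial.X) * Polynomial.derivative u
    + (Polynomial.C A - Polynomial.C (A + B) * Polynomial.X) * u

lemma hasDeriv_TT (A B : ℝ) (u : Polynomial ℝ) {x : ℝ} (hx : x ∈ Set.Ioo (0 : ℝ) 1) :
    HasDerivAt (fun x => u.eval x * wt (A + 1) (B + 1) x) ((TT A B u).eval x * wt A B x) x := by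
  have h1x : (1 : ℝ) - x ≠ 0 := by linarith [hx.2]
  have h1 : HasDerivAt (fun x : ℝ => x ^ A) (A * x ^ (A - 1)) x :=
    Real.hasDerivAt_rpow_const (Or.inl hx.1.ne')
  have h2 : HasDerivAt (fun x : ℝ => (1 - x) ^ B) (-1 * B * (1 - x) ^ (B - 1)) x :=
    ((hasDerivAt_id x).const_sub 1).rpow_const (Or.inl h1x)
  have h3 := (u.hasDerivAt x).mul (h1.mul h2)
  have e : (fun x => u.eval x * wt (A + 1) (B + 1) x) =
      (fun x => u.eval x * (x ^ A * (1 - x) ^ B)) := by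
    ext x; simp [wt]
  rw [e]
  refine h3.congr_deriv ?_
  have e1 : x ^ A = x ^ (A - 1) * x := by
    rw [← Real.rpow_add_one hx.1.ne']; congr 1; ring
  have e2 : (1 - x) ^ B = (1 - x) ^ (B - 1) * (1 - x) := by
    rw [← Real.rpow_add_one h1x]; congr 1; ring
  simp only [TT, wt, Polynomial.eval_add, Polynomial.eval_mul, Polynomial.eval_sub,
    Polynomial.eval_X, Polynomial.eval_C, Polynomial.eval_one, e1, e2, Pi.mul_apply]
  ring

lemma cont_uw {A B : ℝ} (hA : 0 < A) (hB : 0 < B) (u : Polynomial ℝ) :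
    Continuous (fun x => u.eval x * wt (A + 1) (B + 1) x) := by
  simp only [wt, add_sub_cancel_right]
  exact u.continuous.mul ((Real.continuous_rpow_const hA.le).mul
    ((Real.continuous_rpow_const hB.le).comp (continuous_const.sub continuous_id)))

lemma TT_integrable {A B : ℝ} (hA : 0 < A) (hB : 0 < B) (u : Polynomial ℝ) :
    Integrable (fun x => u.eval x * wt A B x) lam := by
  simpa [mul_comm] using integrable_mul_poly (wt_integrable hA hB) u

lemma TT_integral {A B : ℝ} (hA : 0 < A) (hB : 0 < B) (u : Polynomial ℝ) {s t : ℝ}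
    (hs : 0 ≤ s) (hst : s ≤ t) (ht : t ≤ 1) :
    ∫ x in s..t, (TT A B u).eval x * wt A B x =
      u.eval t * wt (A + 1) (B + 1) t - u.eval s * wt (A + 1) (B + 1) s := by
  refine intervalIntegral.integral_eq_sub_of_hasDerivAt_of_le hst
    (f := fun x => u.eval x * wt (A + 1) (B + 1) x) (cont_uw hA hB u).continuousOn
    (fun x hx => hasDeriv_TT A B u ⟨hs.trans_lt hx.1, hx.2.trans_le ht⟩) ?_
  rw [intervalIntegrable_iff_integrableOn_Ioo_of_le hst]
  exact IntegrableOn.mono_set (TT_integrable hA hB (TT A B u)) (Set.Ioo_subset_Ioo hs ht)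

lemma wt_zero {A B : ℝ} (hA : 0 < A) : wt (A + 1) B 0 = 0 := by
  simp [wt, Real.zero_rpow hA.ne']

lemma wt_one {A B : ℝ} (hB : 0 < B) : wt A (B + 1) 1 = 0 := by
  simp [wt, Real.zero_rpow hB.ne']

lemma TT_mean {A B : ℝ} (hA : 0 < A) (hB : 0 < B) (u : Polynomial ℝ) :
    ∫ x, (TT A B u).eval x * wt A B x ∂lam = 0 := by
  rw [integral_lam_eq, TT_integral hA hB u le_rfl zero_le_one le_rfl, wt_zero hA, wt_one hB]
  ring

lemma ibp {h h' : ℝ → ℝ} (H : Pair h h') {A B : ℝ} (hA : 0 < A) (hB : 0 < B)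
    (hi : Integrable (fun t => h' t * wt (A + 1) (B + 1) t) lam) :
    Integrable (fun t => h t * wt A B t) lam ∧
    ∀ u : Polynomial ℝ, ∫ x, h x * wt A B x * (TT A B u).eval x ∂lam =
      - ∫ x, h' x * wt (A + 1) (B + 1) x * u.eval x ∂lam := by
  have h1 : Integrable (fun t => h t * wt A B t) lam := by
    have h2 := (fub H hA hB hi (φ := wt A B) (M := 1) (wt_meas A B).aestronglyMeasurable
      (fun x hx => by rw [abs_of_pos (wt_pos A B hx), one_mul])).1
    have h3 := h2.add ((wt_integrable hA hB).mul_const (h (1 / 2)))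
    refine h3.congr (ae_of_all _ fun x => ?_)
    simp only [Pi.add_apply]; ring
  refine ⟨h1, fun u => ?_⟩
  obtain ⟨M, hM⟩ := poly_bdd (TT A B u)
  obtain ⟨h2, h3⟩ := fub H hA hB hi (φ := fun x => (TT A B u).eval x * wt A B x) (M := M)
    (TT_integrable hA hB _).aestronglyMeasurable
    (fun x hx => by
      rw [abs_mul, abs_of_pos (wt_pos A B hx)]
      exact mul_le_mul_of_nonneg_right (hM x hx) (wt_pos A B hx).le)
  have h4 : ∫ x, (TT A B u).eval x * wt A B x * (h x - h (1 / 2)) ∂lam =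
      ∫ x, h x * wt A B x * (TT A B u).eval x ∂lam := by
    have : ∀ x, (TT A B u).eval x * wt A B x * (h x - h (1 / 2)) =
      h x * wt A B x * (TT A B u).eval x - (TT A B u).eval x * wt A B x * h (1 / 2) := by
      intro x; ring
    simp_rw [this]
    rw [integral_sub (integrable_mul_poly h1 _) ((TT_integrable hA hB _).mul_const _),
      integral_mul_const, TT_mean hA hB, zero_mul, sub_zero]
  rw [← h4, h3, ← integral_neg]
  refine integral_congr_ae (ae_lam fun t ht => ?_)
  have h5 : ∫ x, (TT A B u).eval x * wt A B x * kern x t ∂lam =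
      - (u.eval t * wt (A + 1) (B + 1) t) := by
    rcases lt_or_ge (1 / 2) t with h2 | h2
    · simp_rw [kern_of_gt h2]
      rw [kern_right (f := fun x => (TT A B u).eval x * wt A B x) ht,
        TT_integral hA hB u ht.1.le ht.2.le le_rfl, wt_one hB]
      ring
    · simp_rw [kern_of_le h2, mul_neg]
      rw [integral_neg, kern_left (f := fun x => (TT A B u).eval x * wt A B x) ht,
        TT_integral hA hB u le_rfl ht.1.le ht.2.le, wt_zero hA]
      ring
  simp only [h5]; ring

lemma L2_L1 {h : ℝ → ℝ} (hm : AEStronglyMeasurable h lam) {A B : ℝ} (hA : 0 < A) (hB : 0 < B)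
    (hi : Integrable (fun t => h t ^ 2 * wt A B t) lam) :
    Integrable (fun t => h t * wt A B t) lam := by
  refine (hi.add (wt_integrable hA hB)).mono' (hm.mul (wt_meas A B).aestronglyMeasurable)
    (ae_lam fun x hx => ?_)
  have hw := wt_pos A B hx
  rw [Real.norm_eq_abs, abs_mul, abs_of_pos hw]
  simp only [Pi.add_apply]
  rw [← sq_abs]
  nlinarith [sq_nonneg (|h x| - 1), sq_nonneg (|h x|), abs_nonneg (h x), mul_nonneg hw.le (sq_nonneg (|h x| - 1)), mul_nonneg hw.le (sq_nonneg (|h x|))]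

lemma wt_contOn (A B : ℝ) : ContinuousOn (wt A B) (Set.Ioo 0 1) := by
  intro x hx
  have h1x : (1 : ℝ) - x ≠ 0 := by linarith [hx.2]
  exact ((Real.continuousAt_rpow_const x _ (Or.inl hx.1.ne')).mul
    ((continuousAt_const.sub continuousAt_id).rpow_const (Or.inl h1x))).continuousWithinAt

/-- Hardy-type lemma -/
lemma hardy {h h' : ℝ → ℝ} (H : Pair h h') {A B : ℝ} (hA : 0 < A) (hB : 0 < B)
    (hi : Integrable (fun t => h' t ^ 2 * wt (A + 1) (B + 1) t) lam) :
    Integrable (fun t => h t ^ 2 * wt A B t) lam := by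
  set w := wt (A + 1) (B + 1) with hw
  have hwc : ContinuousOn (fun t => (w t)⁻¹) (Set.Ioo 0 1) :=
    (wt_contOn _ _).inv₀ fun x hx => (wt_pos _ _ hx).ne'
  set G : ℝ → ℝ := fun x => ∫ t in (1/2)..x, (w t)⁻¹ with hG
  have hintg : ∀ x ∈ Set.Ioo (0 : ℝ) 1, ∀ y ∈ Set.Ioo (0 : ℝ) 1,
      IntervalIntegrable (fun t => (w t)⁻¹) volume x y := fun x hx y hy =>
    (hwc.mono (Set.OrdConnected.uIcc_subset Set.ordConnected_Ioo hx hy)).intervalIntegrable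
  have hh : (1 / 2 : ℝ) ∈ Set.Ioo (0 : ℝ) 1 := ⟨by norm_num, by norm_num⟩
  have HG : Pair G (fun t => (w t)⁻¹) := fun x hx y hy =>
    ⟨hintg x hx y hy, intervalIntegral.integral_interval_sub_left (hintg _ hh _ hy) (hintg _ hh _ hx)⟩
  have hGi : Integrable (fun t => G t * wt A B t) lam := by
    refine (ibp HG hA hB ?_).1
    refine (integrable_const (1 : ℝ)).congr (ae_lam fun x hx => ?_)
    exact (inv_mul_cancel₀ (wt_pos _ _ hx).ne').symm
  set K := ∫ t, h' t ^ 2 * w t ∂lam with hK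
  have cs : ∀ x ∈ Set.Ioo (0 : ℝ) 1, ∀ y ∈ Set.Ioo (0 : ℝ) 1, x ≤ y →
      (h y - h x) ^ 2 ≤ K * (G y - G x) := by
    intro x hx y hy hxy
    have hsub : Set.Ioc x y ⊆ Set.Ioo 0 1 := fun z hz => ⟨hx.1.trans hz.1, hz.2.trans_lt hy.2⟩
    have hi2 : IntervalIntegrable (fun t => h' t ^ 2 * w t) volume x y := by
      rw [intervalIntegrable_iff_integrableOn_Ioc_of_le hxy]
      exact IntegrableOn.mono_set hi hsub
    have hKxy : ∫ t in x..y, h' t ^ 2 * w t ≤ K := by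
      rw [intervalIntegral.integral_of_le hxy]
      refine setIntegral_mono_set hi (ae_lam fun t ht => ?_) (LE.le.eventuallyLE hsub)
      exact mul_nonneg (sq_nonneg _) (wt_pos _ _ ht).le
    have hGxy : 0 ≤ G y - G x := by
      rw [(HG x hx y hy).2]
      refine intervalIntegral.integral_nonneg hxy fun t ht => ?_
      exact inv_nonneg.2 (wt_pos _ _ ⟨hx.1.trans_le ht.1, ht.2.trans_lt hy.2⟩).le
    have hq : ∀ l : ℝ, 0 ≤ (∫ t in x..y, h' t ^ 2 * w t) * (l * l) + (2 * (h y - h x)) * l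
        + (G y - G x) := by
      intro l
      rw [(HG x hx y hy).2, (H x hx y hy).2, ← intervalIntegral.integral_mul_const,
        ← intervalIntegral.integral_const_mul, ← intervalIntegral.integral_mul_const,
        ← intervalIntegral.integral_add, ← intervalIntegral.integral_add]
      · refine intervalIntegral.integral_nonneg hxy fun t ht => ?_
        have hp : 0 < w t := wt_pos _ _ ⟨hx.1.trans_le ht.1, ht.2.trans_lt hy.2⟩
        have : h' t ^ 2 * w t * (l * l) + 2 * h' t * l + (w t)⁻¹ =
          (l * h' t * w t + 1) ^ 2 * (w t)⁻¹ := by field_simp; ring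
        rw [this]; positivity
      · exact (hi2.mul_const _).add (((H x hx y hy).1.const_mul _).mul_const _)
      · exact hintg x hx y hy
      · exact hi2.mul_const _
      · exact ((H x hx y hy).1.const_mul _).mul_const _
    have hd := discrim_le_zero hq
    unfold discrim at hd
    nlinarith
  have hcs : ∀ x ∈ Set.Ioo (0 : ℝ) 1, (h x - h (1 / 2)) ^ 2 ≤ K * |G x| := by
    intro x hx
    have hG0 : G (1 / 2) = 0 := by simp [hG]
    have hK0 : 0 ≤ K := integral_nonneg_of_ae (ae_lam fun t ht =>
      mul_nonneg (sq_nonneg _) (wt_pos _ _ ht).le)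
    rcases le_total (1 / 2) x with h1 | h1
    · refine (cs _ hh _ hx h1).trans ?_
      rw [hG0, sub_zero]; gcongr; exact le_abs_self _
    · rw [← neg_sub, neg_sq]
      refine (cs _ hx _ hh h1).trans ?_
      rw [hG0, zero_sub]; gcongr; exact neg_le_abs _
  refine (((hGi.abs.const_mul (2 * K))).add ((wt_integrable hA hB).const_mul
    (2 * h (1 / 2) ^ 2))).mono' (((aesm_of_cont H.continuousOn).pow 2).mul
      (wt_meas A B).aestronglyMeasurable) (ae_lam fun x hx => ?_)
  have hwp := wt_pos A B hx
  simp only [Pi.add_apply]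
  rw [Real.norm_eq_abs, abs_mul, abs_mul, abs_of_pos hwp, abs_of_nonneg (sq_nonneg (h x))]
  have h1 := hcs x hx
  have : h x ^ 2 ≤ 2 * K * |G x| + 2 * h (1 / 2) ^ 2 := by
    nlinarith [sq_nonneg (h x - 2 * h (1 / 2))]
  calc _ ≤ (2 * K * |G x| + 2 * h (1 / 2) ^ 2) * wt A B x := by gcongr
    _ = _ := by ring


/-- Jacobi polynomials (Rodrigues) -/
def JJ : ℝ → ℝ → ℕ → Polynomial ℝ
  | _, _, 0 => 1
  | A, B, k + 1 => TT A B (JJ (A + 1) (B + 1) k)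

/-- squared norms -/
def NN : ℝ → ℝ → ℕ → ℝ
  | A, B, 0 => ∫ x, wt A B x ∂lam
  | A, B, k + 1 => ((k : ℝ) + 1) * (k + (A + B)) * NN (A + 1) (B + 1) k

lemma derivative_TT (A B : ℝ) (u : Polynomial ℝ) :
    Polynomial.derivative (TT A B u) = TT (A + 1) (B + 1) (Polynomial.derivative u)
      - Polynomial.C (A + B) * u := by
  unfold TT
  simp only [Polynomial.derivative_mul, Polynomial.derivative_sub,
    Polynomial.derivative_X, Polynomial.derivative_C, Polynomial.derivative_one, map_add,
    Polynomial.C_1]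
  ring

lemma TT_smul (A B c : ℝ) (u : Polynomial ℝ) :
    TT A B (Polynomial.C c * u) = Polynomial.C c * TT A B u := by
  unfold TT
  simp only [Polynomial.derivative_mul, Polynomial.derivative_C]
  ring

lemma derivative_JJ (k : ℕ) : ∀ A B : ℝ, Polynomial.derivative (JJ A B (k + 1)) =
    - (Polynomial.C (((k : ℝ) + 1) * (k + (A + B))) * JJ (A + 1) (B + 1) k) := by
  induction k with
  | zero => intro A B; simp [JJ, TT, Polynomial.derivative_mul]
  | succ k ih =>
    intro A B
    rw [JJ, derivative_TT, ih, ← neg_mul, ← Polynomial.C_neg, TT_smul]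
    rw [show TT (A + 1) (B + 1) (JJ (A + 1 + 1) (B + 1 + 1) k) = JJ (A + 1) (B + 1) (k + 1) from rfl,
      ← sub_mul, ← Polynomial.C_sub, ← neg_mul (Polynomial.C _) (JJ (A + 1) (B + 1) (k + 1)),
      ← Polynomial.C_neg]
    congr 2
    push_cast; ring

lemma TT_natDegree (A B : ℝ) (u : Polynomial ℝ) {k : ℕ} (hu : u.natDegree ≤ k) :
    (TT A B u).natDegree ≤ k + 1 := by
  unfold TT
  have hd : (Polynomial.derivative u).natDegree ≤ k - 1 :=
    (Polynomial.natDegree_derivative_le u).trans (by omega)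
  rcases Nat.eq_zero_or_pos k with rfl | hk
  · have : Polynomial.derivative u = 0 := by
      rw [Polynomial.eq_C_of_natDegree_le_zero hu, Polynomial.derivative_C]
    rw [this]
    rw [mul_zero, zero_add]
    refine Polynomial.natDegree_mul_le.trans ?_
    have : (Polynomial.C A - Polynomial.C (A + B) * Polynomial.X : Polynomial ℝ).natDegree ≤ 1 := by
      compute_degree
    omega
  · refine Polynomial.natDegree_add_le_of_degree_le ?_ ?_
    · refine Polynomial.natDegree_mul_le.trans ?_
      have : (Polynomial.X * (1 - Polynomial.X) : Polynomial ℝ).natDegree ≤ 2 := by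
        compute_degree
      omega
    · refine Polynomial.natDegree_mul_le.trans ?_
      have : (Polynomial.C A - Polynomial.C (A + B) * Polynomial.X : Polynomial ℝ).natDegree ≤ 1 := by
        compute_degree
      omega

lemma TT_coeff (A B : ℝ) (u : Polynomial ℝ) {k : ℕ} (hu : u.natDegree ≤ k) :
    (TT A B u).coeff (k + 1) = - (k + (A + B)) * u.coeff k := by
  have h0 : u.coeff (k + 1) = 0 := Polynomial.coeff_eq_zero_of_natDegree_lt (by omega)
  have e : TT A B u = Polynomial.X * Polynomial.derivative u
      - Polynomial.X * (Polynomial.X * Polynomial.derivative u)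
      + Polynomial.C A * u - Polynomial.C (A + B) * (Polynomial.X * u) := by
    unfold TT; ring
  have h1 : (Polynomial.X * Polynomial.derivative u).coeff k = k * u.coeff k := by
    cases k with
    | zero => simp
    | succ k => rw [Polynomial.coeff_X_mul, Polynomial.coeff_derivative]; push_cast; ring
  rw [e]
  simp only [Polynomial.coeff_add, Polynomial.coeff_sub, Polynomial.coeff_X_mul,
    Polynomial.coeff_C_mul, Polynomial.coeff_derivative, h0, h1]
  ring

lemma JJ_deg (k : ℕ) : ∀ A B : ℝ, 0 < A → 0 < B →
    (JJ A B k).natDegree ≤ k ∧ (JJ A B k).coeff k ≠ 0 := by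
  induction k with
  | zero => intro A B _ _; simp [JJ]
  | succ k ih =>
    intro A B hA hB
    obtain ⟨h1, h2⟩ := ih (A + 1) (B + 1) (by linarith) (by linarith)
    refine ⟨TT_natDegree A B _ h1, ?_⟩
    rw [JJ, TT_coeff A B _ h1]
    exact mul_ne_zero (by have : (0:ℝ) ≤ k := Nat.cast_nonneg k
                          intro h; linarith) h2

lemma JJ_span {A B : ℝ} (hA : 0 < A) (hB : 0 < B) :
    Submodule.span ℝ (Set.range (JJ A B)) = ⊤ := by
  have hdeg : ∀ k, (JJ A B k).degree = k := fun k =>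
    Polynomial.degree_eq_of_le_of_coeff_ne_zero
      (Polynomial.degree_le_of_natDegree_le (JJ_deg k A B hA hB).1) (JJ_deg k A B hA hB).2
  let S : Polynomial.Sequence ℝ := ⟨JJ A B, hdeg⟩
  exact S.span (fun i => isUnit_iff_ne_zero.2 (Polynomial.leadingCoeff_ne_zero.2 (S.ne_zero i)))

/-- orthogonality to all `JJ` implies to all polynomials -/
lemma orth_all {A B : ℝ} (hA : 0 < A) (hB : 0 < B) {f : ℝ → ℝ} (hf : Integrable f lam)
    (h : ∀ k, ∫ x, f x * (JJ A B k).eval x ∂lam = 0) (p : Polynomial ℝ) :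
    ∫ x, f x * p.eval x ∂lam = 0 := by
  have hp : p ∈ Submodule.span ℝ (Set.range (JJ A B)) := by rw [JJ_span hA hB]; trivial
  induction hp using Submodule.span_induction with
  | mem x hx => obtain ⟨k, rfl⟩ := hx; exact h k
  | zero => simp
  | add x y _ _ hx hy =>
    simp_rw [Polynomial.eval_add, mul_add]
    rw [integral_add (integrable_mul_poly hf x) (integrable_mul_poly hf y), hx, hy, add_zero]
  | smul c x _ hx =>
    simp_rw [Polynomial.eval_smul, smul_eq_mul, mul_left_comm]
    rw [integral_const_mul, hx, mul_zero]

lemma Pair.poly (p : Polynomial ℝ) : Pair (fun x => p.eval x)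
    (fun x => (Polynomial.derivative p).eval x) :=
  Pair.of_deriv (fun x _ => p.hasDerivAt x) (Polynomial.continuous _).continuousOn

lemma ibp_poly {A B : ℝ} (hA : 0 < A) (hB : 0 < B) (p u : Polynomial ℝ) :
    ∫ x, p.eval x * wt A B x * (TT A B u).eval x ∂lam =
      - ∫ x, (Polynomial.derivative p).eval x * wt (A + 1) (B + 1) x * u.eval x ∂lam :=
  (ibp (Pair.poly p) hA hB (TT_integrable (by linarith) (by linarith) _)).2 u

lemma JJ_orth (k : ℕ) : ∀ (l : ℕ) (A B : ℝ), 0 < A → 0 < B →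
    ∫ x, (JJ A B k).eval x * wt A B x * (JJ A B l).eval x ∂lam = if k = l then NN A B k else 0 := by
  induction k with
  | zero =>
    intro l A B hA hB
    cases l with
    | zero => simp [JJ, NN]
    | succ l => rw [show JJ A B (l + 1) = TT A B (JJ (A + 1) (B + 1) l) from rfl, ibp_poly hA hB]
                simp [JJ]
  | succ k ih =>
    intro l A B hA hB
    cases l with
    | zero =>
      simp_rw [mul_comm _ (Polynomial.eval _ (JJ A B 0)), mul_comm _ (wt A B _), ← mul_assoc]
      rw [show JJ A B (k + 1) = TT A B (JJ (A + 1) (B + 1) k) from rfl, ibp_poly hA hB]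
      simp [JJ]
    | succ l =>
      rw [show JJ A B (l + 1) = TT A B (JJ (A + 1) (B + 1) l) from rfl, ibp_poly hA hB,
        derivative_JJ]
      simp only [Polynomial.eval_neg, Polynomial.eval_mul, Polynomial.eval_C, neg_mul]
      simp_rw [mul_assoc]
      rw [integral_neg, neg_neg, integral_const_mul, integral_const_mul]
      simp_rw [← mul_assoc]
      rw [ih l (A + 1) (B + 1) (by linarith) (by linarith)]
      by_cases h : k = l <;> simp [h, NN]

lemma wt_int_pos {A B : ℝ} (hA : 0 < A) (hB : 0 < B) : 0 < ∫ x, wt A B x ∂lam := by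
  rw [integral_pos_iff_support_of_nonneg_ae (ae_lam fun x hx => (wt_pos A B hx).le)
    (wt_integrable hA hB)]
  have : lam (Set.Ioo 0 1) ≤ lam (Function.support (wt A B)) :=
    measure_mono fun x hx => (wt_pos A B hx).ne'
  refine lt_of_lt_of_le ?_ this
  simp [lam]

lemma NN_pos (k : ℕ) : ∀ {A B : ℝ}, 0 < A → 0 < B → 0 < NN A B k := by
  induction k with
  | zero => intro A B hA hB; exact wt_int_pos hA hB
  | succ k ih =>
    intro A B hA hB
    have := ih (A := A + 1) (B := B + 1) (by linarith) (by linarith)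
    rw [NN]; positivity

lemma inner_toLp {f g : ℝ → ℝ} (hf : MemLp f 2 lam) (hg : MemLp g 2 lam) :
    inner ℝ (hf.toLp f) (hg.toLp g) = ∫ x, f x * g x ∂lam := by
  rw [L2.inner_def]
  refine integral_congr_ae ?_
  filter_upwards [hf.coeFn_toLp, hg.coeFn_toLp] with x h1 h2
  rw [h1, h2]; simp [mul_comm]

lemma memLp_sqrt {h : ℝ → ℝ} (hm : AEStronglyMeasurable h lam) {A B : ℝ}
    (hi : Integrable (fun t => h t ^ 2 * wt A B t) lam) :
    MemLp (fun x => h x * √(wt A B x)) 2 lam := by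
  refine (memLp_two_iff_integrable_sq (hm.mul (wt_meas A B).sqrt.aestronglyMeasurable)).2 ?_
  refine hi.congr (ae_lam fun x hx => ?_)
  simp only [Pi.mul_apply, mul_pow]
  rw [Real.sq_sqrt (wt_pos A B hx).le]

lemma JJ_sq_int {A B : ℝ} (hA : 0 < A) (hB : 0 < B) (k : ℕ) (c : ℝ) :
    Integrable (fun t => (c * (JJ A B k).eval t) ^ 2 * wt A B t) lam := by
  have := TT_integrable hA hB ((Polynomial.C c * JJ A B k) ^ 2)
  simpa using this

theorem parseval {A B : ℝ} (hA : 0 < A) (hB : 0 < B) {h : ℝ → ℝ}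
    (hm : AEStronglyMeasurable h lam) (hi : Integrable (fun t => h t ^ 2 * wt A B t) lam) :
    HasSum (fun k => (∫ x, h x * wt A B x * (JJ A B k).eval x ∂lam) ^ 2 / NN A B k)
      (∫ x, h x ^ 2 * wt A B x ∂lam) := by
  have hv : ∀ k, MemLp (fun x => ((√(NN A B k))⁻¹ * (JJ A B k).eval x) * √(wt A B x)) 2 lam :=
    fun k => memLp_sqrt (continuous_const.mul (Polynomial.continuous _)).aestronglyMeasurable
      (JJ_sq_int hA hB k _)
  set v : ℕ → Lp ℝ 2 lam := fun k => (hv k).toLp _ with hvdef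
  have hN := fun k => NN_pos k hA hB
  have hon : Orthonormal ℝ v := by
    rw [orthonormal_iff_ite]
    intro k l
    simp only [hvdef]
    rw [inner_toLp]
    have : ∫ x, (√(NN A B k))⁻¹ * (JJ A B k).eval x * √(wt A B x) *
        ((√(NN A B l))⁻¹ * (JJ A B l).eval x * √(wt A B x)) ∂lam =
        ∫ x, ((√(NN A B k))⁻¹ * (√(NN A B l))⁻¹) *
          ((JJ A B k).eval x * wt A B x * (JJ A B l).eval x) ∂lam := by
      refine integral_congr_ae (ae_lam fun x hx => ?_)
      simp only
      nth_rewrite 3 [← Real.mul_self_sqrt (wt_pos A B hx).le]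
      ring
    rw [this, integral_const_mul, JJ_orth k l A B hA hB]
    split_ifs with hkl
    · subst hkl
      rw [← mul_inv, Real.mul_self_sqrt (hN k).le, inv_mul_cancel₀ (hN k).ne']
    · simp
  have hsp : (Submodule.span ℝ (Set.range v))ᗮ = ⊥ := by
    rw [eq_bot_iff]
    intro φ hφ
    rw [Submodule.mem_orthogonal] at hφ
    have hφL : MemLp φ 2 lam := Lp.memLp φ
    have hsq : MemLp (fun x => √(wt A B x)) 2 lam := by
      have := memLp_sqrt (h := fun _ => 1) aestronglyMeasurable_const (A := A) (B := B)
        (by simpa using wt_integrable hA hB)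
      simpa using this
    have hintg : Integrable (fun x => √(wt A B x) * φ x) lam := hsq.integrable_mul hφL
    have h0 : ∀ k, ∫ x, √(wt A B x) * φ x * (JJ A B k).eval x ∂lam = 0 := by
      intro k
      have h1 := hφ (v k) (Submodule.subset_span ⟨k, rfl⟩)
      rw [← Lp.toLp_coeFn φ hφL, inner_toLp] at h1
      have h2 : ∫ x, (√(NN A B k))⁻¹ * (JJ A B k).eval x * √(wt A B x) * φ x ∂lam =
        ∫ x, (√(NN A B k))⁻¹ * (√(wt A B x) * φ x * (JJ A B k).eval x) ∂lam := by
        congr 1; ext x; ring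
      rw [h2, integral_const_mul] at h1
      exact (mul_eq_zero.1 h1).resolve_left (inv_ne_zero (Real.sqrt_pos.2 (hN k)).ne')
    have h1 := determinacy hintg (orth_all hA hB hintg h0)
    rw [Submodule.mem_bot, Lp.eq_zero_iff_ae_eq_zero]
    filter_upwards [h1, ae_lam (fun x hx => (Real.sqrt_pos.2 (wt_pos A B hx)).ne')] with x h2 h3
    exact (mul_eq_zero.1 h2).resolve_left h3
  set b := HilbertBasis.mkOfOrthogonalEqBot hon hsp with hb
  have hf := memLp_sqrt hm hi
  have hs := b.hasSum_inner_mul_inner (hf.toLp _) (hf.toLp _)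
  rw [inner_toLp] at hs
  have hbv : ∀ k, b k = v k := fun k => by
    rw [hb, HilbertBasis.coe_mkOfOrthogonalEqBot]
  have e1 : ∫ x, h x * √(wt A B x) * (h x * √(wt A B x)) ∂lam = ∫ x, h x ^ 2 * wt A B x ∂lam := by
    refine integral_congr_ae (ae_lam fun x hx => ?_)
    simp only
    nth_rewrite 3 [← Real.mul_self_sqrt (wt_pos A B hx).le]
    ring
  rw [e1] at hs
  refine hs.congr_fun ?_
  intro k
  have e2 : inner ℝ (hf.toLp _) (v k) =
      (√(NN A B k))⁻¹ * ∫ x, h x * wt A B x * (JJ A B k).eval x ∂lam := by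
    simp only [hvdef]
    rw [inner_toLp, ← integral_const_mul]
    refine integral_congr_ae (ae_lam fun x hx => ?_)
    simp only
    nth_rewrite 3 [← Real.mul_self_sqrt (wt_pos A B hx).le]
    ring
  rw [hbv, real_inner_comm _ (v k), e2]
  have := Real.mul_self_sqrt (hN k).le
  have h3 := (Real.sqrt_pos.2 (hN k)).ne'
  nth_rewrite 1 [← this]
  field_simp


lemma fall_succ (x : ℝ) (k : ℕ) : fall x (k + 1) = fall x k * (x - k) := by
  simp [fall, Finset.prod_range_succ]

lemma fall_succ' (x : ℝ) (k : ℕ) : fall (x + 1) (k + 1) = (x + 1) * fall x k := by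
  simp only [fall, Finset.prod_range_succ']
  rw [mul_comm]
  congr 1
  · simp
  · refine Finset.prod_congr rfl fun j _ => ?_
    push_cast; ring

lemma rise_succ (x : ℝ) (k : ℕ) : rise x (k + 1) = rise x k * (x + k) := by
  simp [rise, Finset.prod_range_succ]

lemma rise_succ' (x : ℝ) (k : ℕ) : rise x (k + 1) = x * rise (x + 1) k := by
  simp only [rise, Finset.prod_range_succ']
  rw [mul_comm]
  congr 1
  · simp
  · refine Finset.prod_congr rfl fun j _ => ?_
    push_cast; ring

lemma rise_pos {x : ℝ} (hx : 0 < x) (k : ℕ) : 0 < rise x k :=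
  Finset.prod_pos fun j _ => by positivity

lemma fall_pos {M k : ℕ} (h : k ≤ M) : 0 < fall (M : ℝ) k :=
  Finset.prod_pos fun j hj => by
    have : (j : ℝ) < M := by exact_mod_cast (Finset.mem_range.1 hj).trans_le h
    linarith

lemma fall_eq_zero {M k : ℕ} (h : M < k) : fall (M : ℝ) k = 0 :=
  Finset.prod_eq_zero (Finset.mem_range.2 h) (by simp)

/-- coefficients in the bound -/
def ac (s : ℝ) (m n i : ℕ) : ℝ :=
  (-1) ^ i * ((n.choose i : ℝ) / (fall ((m : ℝ) + n) i * rise (s + m) i))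

/-- the eigenvalues -/
def pt (s t : ℝ) : ℝ := t * (s - 1 + t)

/-- the multiplier -/
def rho (s : ℝ) (m n : ℕ) (κ : ℝ) : ℝ := ∏ j ∈ Finset.range n, (1 - κ / pt s (m + 1 + j))

lemma ac_rec {s : ℝ} (hs : 0 < s) (m n i : ℕ) (hi : i ≤ n) :
    pt s (m + 1 + n) * ac s m (n + 1) (i + 1) =
      ac s m n (i + 1) * (pt s (m + 1 + n) - pt s ((i + 1 : ℕ) : ℝ)) - ac s m n i := by
  have hch : (n.choose (i + 1) : ℝ) * (i + 1) = n.choose i * (n - i) := by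
    have := Nat.choose_succ_right_eq n i
    have h2 : ((n.choose (i + 1) * (i + 1) : ℕ) : ℝ) = ((n.choose i * (n - i) : ℕ) : ℝ) := by
      rw [this]
    push_cast [Nat.cast_sub hi] at h2
    exact h2
  have hm0 : (0 : ℝ) ≤ m := Nat.cast_nonneg m
  have hn0 : (0 : ℝ) ≤ n := Nat.cast_nonneg n
  have hi0 : (0 : ℝ) ≤ i := Nat.cast_nonneg i
  have hf : fall ((m : ℝ) + n) i ≠ 0 := by
    have := fall_pos (M := m + n) (k := i) (by omega)
    push_cast at this
    exact this.ne'
  have hr := (rise_pos (x := s + m) (by linarith) i).ne'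
  have e1 : fall ((m : ℝ) + (n + 1 : ℕ)) (i + 1) = (m + n + 1) * fall ((m : ℝ) + n) i := by
    rw [← fall_succ']; push_cast; ring_nf
  have hne1 : (m : ℝ) + n + 1 ≠ 0 := by positivity
  have hne2 : s + m + i ≠ 0 := by positivity
  unfold ac
  rw [e1, fall_succ, rise_succ, Nat.choose_succ_succ]
  unfold pt
  rcases hi.lt_or_eq with hlt | rfl
  · have hne3 : (m : ℝ) + n - i ≠ 0 := by
      have : (i : ℝ) < n := by exact_mod_cast hlt
      intro h; linarith
    have hi1 : (i : ℝ) + 1 ≠ 0 := by positivity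
    have hc : (n.choose (i + 1) : ℝ) = n.choose i * (n - i) / (i + 1) := by
      rw [eq_div_iff hi1, hch]
    push_cast
    rw [hc]
    field_simp
    ring
  · simp only [Nat.choose_succ_self, Nat.cast_zero, Nat.choose_self]
    push_cast
    field_simp
    ring

lemma saal {s : ℝ} (hs : 0 < s) (m : ℕ) (κ : ℝ) (n : ℕ) :
    ∑ i ∈ Finset.range (n + 1), ac s m n i * ∏ j ∈ Finset.range i, (κ - pt s j) = rho s m n κ := by
  induction n with
  | zero => simp [ac, rho, fall, rise]
  | succ n ih =>
    have hp : pt s (m + 1 + n) ≠ 0 := by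
      unfold pt
      have h1 : (0 : ℝ) < m + 1 + n := by positivity
      have h2 : 0 < s - 1 + (m + 1 + n) := by
        have : (0:ℝ) ≤ m := Nat.cast_nonneg m
        have : (0:ℝ) ≤ n := Nat.cast_nonneg n
        linarith
      positivity
    apply mul_left_cancel₀ hp
    have hR : pt s (m + 1 + n) * rho s m (n + 1) κ = (pt s (m + 1 + n) - κ) * rho s m n κ := by
      unfold rho
      rw [Finset.prod_range_succ]
      field_simp
    rw [hR, ← ih, Finset.sum_range_succ', mul_add, Finset.mul_sum]
    set X : ℕ → ℝ := fun i => ∏ j ∈ Finset.range i, (κ - pt s j) with hX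
    have hXs : ∀ i, X (i + 1) = X i * (κ - pt s i) := fun i => by
      simp [hX, Finset.prod_range_succ]
    have h1 : ∑ i ∈ Finset.range (n + 1), pt s (m + 1 + n) * (ac s m (n + 1) (i + 1) * X (i + 1)) =
        ∑ i ∈ Finset.range (n + 1),
          ac s m n (i + 1) * (pt s (m + 1 + n) - pt s ((i + 1 : ℕ) : ℝ)) * X (i + 1)
        - ∑ i ∈ Finset.range (n + 1), ac s m n i * X (i + 1) := by
      rw [← Finset.sum_sub_distrib]
      refine Finset.sum_congr rfl fun i hi => ?_
      rw [← mul_assoc, ac_rec hs m n i (by simpa [Nat.lt_succ_iff] using hi)]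
      ring
    have h2 := Finset.sum_range_succ'
      (fun i => ac s m n i * (pt s (m + 1 + n) - pt s (i : ℝ)) * X i) (n + 1)
    rw [Finset.sum_range_succ] at h2
    have h3 : ac s m n (n + 1) = 0 := by simp [ac]
    have h4 : ac s m n 0 = 1 := by simp [ac, fall, rise]
    have h5 : ac s m (n + 1) 0 = 1 := by simp [ac, fall, rise]
    have h6 : X 0 = 1 := by simp [hX]
    have h7 : pt s ((0 : ℕ) : ℝ) = 0 := by simp [pt]
    rw [h3, h4, h6, h7] at h2
    change ∑ i ∈ Finset.range (n + 1), pt s (m + 1 + n) * (ac s m (n + 1) (i + 1) * X (i + 1)) +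
      pt s (m + 1 + n) * (ac s m (n + 1) 0 * X 0) =
      (pt s (m + 1 + n) - κ) * ∑ i ∈ Finset.range (n + 1), ac s m n i * X i
    rw [h1, h5, h6]
    have h8 : ∑ i ∈ Finset.range (n + 1), ac s m n i * (pt s (m + 1 + n) - pt s (i : ℝ)) * X i
        - ∑ i ∈ Finset.range (n + 1), ac s m n i * X (i + 1) =
        (pt s (m + 1 + n) - κ) * ∑ i ∈ Finset.range (n + 1), ac s m n i * X i := by
      rw [← Finset.sum_sub_distrib, Finset.mul_sum]
      refine Finset.sum_congr rfl fun i _ => ?_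
      rw [hXs]; ring
    rw [← h8]
    linarith

lemma prod_kappa (s : ℝ) (k : ℝ) (i : ℕ) :
    ∏ j ∈ Finset.range i, (pt s k - pt s j) = fall k i * rise (k + s - 1) i := by
  unfold fall rise
  rw [← Finset.prod_mul_distrib]
  refine Finset.prod_congr rfl fun j _ => ?_
  unfold pt; ring

lemma rho_factor {s : ℝ} (hs : 0 < s) (m j : ℕ) (k : ℝ) :
    1 - pt s k / pt s (m + 1 + j) = (m + 1 + j - k) * (s + m + j + k) / ((m + 1 + j) * (s + m + j)) := by
  have h1 : (m : ℝ) + 1 + j ≠ 0 := by positivity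
  have h2 : s + m + j ≠ 0 := by positivity
  have h3 : s - 1 + ((m : ℝ) + 1 + j) ≠ 0 := by convert h2 using 1; ring
  unfold pt
  have : s - 1 + ((m : ℝ) + 1 + j) = s + m + j := by ring
  rw [this]
  field_simp
  ring

lemma rho_zero {s : ℝ} (hs : 0 < s) {m n k : ℕ} (h1 : m < k) (h2 : k ≤ m + n) :
    rho s m n (pt s k) = 0 := by
  refine Finset.prod_eq_zero (i := k - m - 1) (Finset.mem_range.2 (by omega)) ?_
  rw [rho_factor hs]
  have : ((k - m - 1 : ℕ) : ℝ) = k - m - 1 := by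
    rw [Nat.cast_sub (by omega), Nat.cast_sub (by omega)]; simp
  rw [this]
  have h3 : (m : ℝ) + 1 + (k - m - 1) - k = 0 := by ring
  rw [h3, zero_mul, zero_div]

lemma rho_sign {s : ℝ} (hs : 0 < s) {m n k : ℕ} (h : m + n < k) :
    0 < (-1) ^ n * rho s m n (pt s k) := by
  have : (-1 : ℝ) ^ n = ∏ j ∈ Finset.range n, (-1 : ℝ) := by simp
  unfold rho
  rw [this, ← Finset.prod_mul_distrib]
  refine Finset.prod_pos fun j hj => ?_
  rw [rho_factor hs, neg_one_mul, ← neg_div]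
  have h1 : (m : ℝ) + 1 + j - k < 0 := by
    have : m + 1 + j < k := by have := Finset.mem_range.1 hj; omega
    have : (m : ℝ) + 1 + j < k := by exact_mod_cast this
    linarith
  have h2 : 0 < s + m + j + k := by positivity
  apply div_pos _ (by positivity)
  nlinarith [mul_pos (neg_pos.2 h1) h2]

lemma rho_small {s : ℝ} (hs : 0 < s) {m k : ℕ} (h : k ≤ m) (n : ℕ) :
    rho s m n (pt s k) =
      fall (m : ℝ) k * rise (s + m + k) n / (fall ((m : ℝ) + n) k * rise (s + m) n) := by
  have hm0 : (0 : ℝ) ≤ m := Nat.cast_nonneg m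
  induction n with
  | zero =>
    have := (fall_pos h).ne'
    simp [rho, rise, this]
  | succ n ih =>
    have e : rho s m (n + 1) (pt s k) = rho s m n (pt s k) * (1 - pt s k / pt s (m + 1 + n)) := by
      simp [rho, Finset.prod_range_succ]
    have hf1 : fall ((m : ℝ) + n) k ≠ 0 := by
      have := fall_pos (M := m + n) (k := k) (by omega)
      push_cast at this
      exact this.ne'
    have hf2 : fall ((m : ℝ) + n + 1) k ≠ 0 := by
      have := fall_pos (M := m + n + 1) (k := k) (by omega)
      push_cast at this
      exact this.ne'
    have hff : fall ((m : ℝ) + n + 1) k * (m + n + 1 - k) = (m + n + 1) * fall ((m : ℝ) + n) k := by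
      rw [← fall_succ, fall_succ']
    have hr := (rise_pos (x := s + m) (by linarith) n).ne'
    have h1 : (m : ℝ) + 1 + n ≠ 0 := by positivity
    have h2 : s + m + n ≠ 0 := by positivity
    rw [e, ih, rho_factor hs, rise_succ, rise_succ]
    push_cast
    rw [← add_assoc]
    rw [div_mul_div_comm, div_eq_div_iff (by positivity) (by positivity)]
    linear_combination (fall (m : ℝ) k * rise (s + m + k) n * (s + m + n + k) * rise (s + m) n * (s + m + n)) * hff

lemma fall_choose (m k : ℕ) : fall (m : ℝ) k = m.choose k * fall (k : ℝ) k := by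
  have h : ∀ m k : ℕ, fall (m : ℝ) k = m.descFactorial k := by
    intro m k
    induction k with
    | zero => simp [fall]
    | succ k ih =>
      rw [fall_succ, ih, Nat.descFactorial_succ]
      rcases le_or_gt k m with h | h
      · push_cast [Nat.cast_sub h]; ring
      · rw [Nat.descFactorial_eq_zero_iff_lt.2 h]; simp
  rw [h, h, Nat.descFactorial_self, Nat.descFactorial_eq_factorial_mul_choose]
  push_cast; ring

lemma NN_shift (k i : ℕ) : ∀ A B : ℝ, NN A B (k + i) =
    fall ((k + i : ℕ) : ℝ) i * rise ((k + i : ℕ) + (A + B) - 1) i * NN (A + i) (B + i) k := by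
  induction i with
  | zero => intro A B; simp [fall, rise]
  | succ i ih =>
    intro A B
    rw [show k + (i + 1) = (k + i) + 1 from rfl, NN, ih]
    have e1 : (((k + i + 1 : ℕ) : ℝ)) = ((k + i : ℕ) : ℝ) + 1 := by push_cast; ring
    rw [e1, fall_succ', rise_succ']
    have e2 : ((k + i : ℕ) : ℝ) + (A + 1 + (B + 1)) - 1 = ((k + i : ℕ) : ℝ) + 1 + (A + B) - 1 + 1 := by
      ring
    have e3 : A + 1 + (i : ℝ) = A + ((i + 1 : ℕ) : ℝ) := by push_cast; ring
    have e4 : B + 1 + (i : ℝ) = B + ((i + 1 : ℕ) : ℝ) := by push_cast; ring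
    rw [e2, e3, e4]
    ring

lemma wt_int_succ {A B : ℝ} (hA : 0 < A) (hB : 0 < B) :
    ∫ x, wt (A + 1) (B + 1) x ∂lam = A * B / ((A + B) * (A + B + 1)) * ∫ x, wt A B x ∂lam := by
  have h1 := TT_mean hA hB 1
  have h2 := TT_mean hA hB Polynomial.X
  have hx := TT_integrable hA hB Polynomial.X
  have hw := wt_integrable hA hB
  have hw1 := wt_integrable (A := A + 1) (B := B + 1) (by linarith) (by linarith)
  simp only [Polynomial.eval_X] at hx
  have e1 : ∀ x, (TT A B 1).eval x * wt A B x = A * wt A B x - (A + B) * (x * wt A B x) := by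
    intro x; simp [TT]; ring
  have e2 : ∀ x ∈ Set.Ioo (0:ℝ) 1, (TT A B Polynomial.X).eval x * wt A B x =
      (A + B + 1) * wt (A + 1) (B + 1) x - B * (x * wt A B x) := by
    intro x hx; rw [wt_succ A B hx]; simp [TT]; ring
  simp_rw [e1] at h1
  rw [integral_sub (hw.const_mul _) (hx.const_mul _), integral_const_mul, integral_const_mul] at h1
  rw [integral_congr_ae (ae_lam e2), integral_sub (hw1.const_mul _) (hx.const_mul _),
    integral_const_mul, integral_const_mul] at h2
  have hs : A + B ≠ 0 := by positivity
  have hs1 : A + B + 1 ≠ 0 := by positivity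
  rw [div_mul_eq_mul_div, eq_div_iff (mul_ne_zero hs hs1)]
  linear_combination (-B) * h1 + (A + B) * h2

lemma wt_int_shift {A B : ℝ} (hA : 0 < A) (hB : 0 < B) (k : ℕ) :
    ∫ x, wt (A + k) (B + k) x ∂lam =
      rise A k * rise B k / rise (A + B) (2 * k) * ∫ x, wt A B x ∂lam := by
  induction k with
  | zero => simp [rise]
  | succ k ih =>
    have e3 : A + ((k + 1 : ℕ) : ℝ) = A + k + 1 := by push_cast; ring
    have e4 : B + ((k + 1 : ℕ) : ℝ) = B + k + 1 := by push_cast; ring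
    rw [e3, e4, wt_int_succ (by positivity) (by positivity), ih,
      show 2 * (k + 1) = 2 * k + 1 + 1 from rfl]
    simp only [rise_succ]
    have hr := (rise_pos (x := A + B) (by linarith) (2 * k)).ne'
    have h1 : A + B + 2 * k ≠ 0 := by positivity
    have h2 : A + B + 2 * k + 1 ≠ 0 := by positivity
    have h3 : A + k + (B + k) = A + B + 2 * k := by ring
    push_cast
    rw [h3, ← add_assoc]
    field_simp


/-- the normalizing constant -/
def cst (a b : ℝ) : ℝ := Real.Gamma (a + b) / (Real.Gamma a * Real.Gamma b)

lemma cst_pos {a b : ℝ} (ha : 0 < a) (hb : 0 < b) : 0 < cst a b :=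
  div_pos (Real.Gamma_pos_of_pos (add_pos ha hb))
    (mul_pos (Real.Gamma_pos_of_pos ha) (Real.Gamma_pos_of_pos hb))

lemma dens_eq (a b : ℝ) :
    volume.withDensity (fun x => ENNReal.ofReal (betaDensity a b x)) =
      lam.withDensity (fun x => ENNReal.ofReal (cst a b * wt a b x)) := by
  rw [lam, ← withDensity_indicator measurableSet_Ioo]
  congr 1
  ext x
  by_cases hx : x ∈ Set.Ioo (0 : ℝ) 1
  · simp [betaDensity, hx, wt, cst, mul_assoc]
  · simp only [betaDensity, if_neg hx, Set.indicator_of_notMem hx, ENNReal.ofReal_zero]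

lemma isProb {a b : ℝ} (ha : 0 < a) (hb : 0 < b) :
    IsProbabilityMeasure (volume.withDensity (fun x => ENNReal.ofReal (betaDensity a b x))) := by
  have h := isProbabilityMeasureBeta ha hb
  have e : betaMeasure a b = volume.withDensity (fun x => ENNReal.ofReal (betaDensity a b x)) := by
    unfold betaMeasure
    congr 1
    ext x
    rw [betaPDF_eq]
    simp only [betaDensity, Set.mem_Ioo, beta, one_div_div]
  rwa [← e]

lemma dens_integral {a b : ℝ} (ha : 0 < a) (hb : 0 < b) (f : ℝ → ℝ) :
    ∫ x, f x ∂(volume.withDensity (fun x => ENNReal.ofReal (betaDensity a b x))) =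
      cst a b * ∫ x, f x * wt a b x ∂lam := by
  rw [dens_eq, integral_withDensity_eq_integral_toReal_smul
    ((wt_meas a b).const_mul _).ennreal_ofReal (by simp), ← integral_const_mul]
  refine integral_congr_ae (ae_lam fun x hx => ?_)
  have := wt_pos a b hx
  have := cst_pos ha hb
  simp only [smul_eq_mul]
  rw [ENNReal.toReal_ofReal (by positivity)]
  ring

lemma dens_integrable {a b : ℝ} (ha : 0 < a) (hb : 0 < b) (f : ℝ → ℝ) :
    Integrable f (volume.withDensity (fun x => ENNReal.ofReal (betaDensity a b x))) ↔
      Integrable (fun x => f x * wt a b x) lam := by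
  have hc := cst_pos ha hb
  rw [dens_eq, integrable_withDensity_iff_integrable_smul'
    ((wt_meas a b).const_mul _).ennreal_ofReal (by simp),
    ← integrable_const_mul_iff (isUnit_iff_ne_zero.2 hc.ne') (fun x => f x * wt a b x)]
  refine integrable_congr (ae_lam fun x hx => ?_)
  have := wt_pos a b hx
  simp only [smul_eq_mul]
  rw [ENNReal.toReal_ofReal (by positivity)]
  ring

lemma wt_shift (a b : ℝ) (i : ℕ) {x : ℝ} (hx : x ∈ Set.Ioo (0 : ℝ) 1) :
    wt (a + i) (b + i) x = (x * (1 - x)) ^ i * wt a b x := by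
  induction i with
  | zero => simp
  | succ i ih =>
    push_cast
    rw [← add_assoc, ← add_assoc, wt_succ _ _ hx, ih]; ring

lemma cst_wt {a b : ℝ} (ha : 0 < a) (hb : 0 < b) : cst a b * ∫ x, wt a b x ∂lam = 1 := by
  have h := isProb ha hb
  have h2 := dens_integral ha hb (fun _ => 1)
  simpa using h2.symm

/-- integral of weighted expressions -/
lemma dens_integral_q {a b : ℝ} (ha : 0 < a) (hb : 0 < b) (i : ℕ) (f : ℝ → ℝ) :
    ∫ x, x ^ i * (1 - x) ^ i * f x
      ∂(volume.withDensity (fun x => ENNReal.ofReal (betaDensity a b x))) =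
      cst a b * ∫ x, f x * wt (a + i) (b + i) x ∂lam := by
  rw [dens_integral ha hb]
  congr 1
  refine integral_congr_ae (ae_lam fun x hx => ?_)
  simp only [wt_shift a b i hx, mul_pow]
  ring

lemma dens_integrable_q {a b : ℝ} (ha : 0 < a) (hb : 0 < b) (i : ℕ) (f : ℝ → ℝ) :
    Integrable (fun x => (x * (1 - x)) ^ i * f x)
      (volume.withDensity (fun x => ENNReal.ofReal (betaDensity a b x))) ↔
      Integrable (fun x => f x * wt (a + i) (b + i) x) lam := by
  rw [dens_integrable ha hb]
  refine integrable_congr (ae_lam fun x hx => ?_)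
  simp only [wt_shift a b i hx, mul_pow]
  ring

lemma mem_pair {P : Measure ℝ} {q : ℝ → ℝ} {m n : ℕ} {gd : ℕ → ℝ → ℝ}
    (hg : MemH P q (Set.Ioo 0 1) m n gd) {k : ℕ} (hk : k < max m n) :
    Pair (gd k) (gd (k + 1)) := by
  obtain ⟨h1, h2, h3, -, -⟩ := hg
  by_cases h : k + 1 < max m n
  · refine Pair.of_deriv (h1 k h) ?_
    by_cases h' : k + 1 + 1 < max m n
    · exact fun x hx => (h1 (k + 1) h' x hx).continuousAt.continuousWithinAt
    · have e : max m n - 1 = k + 1 := by omega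
      rw [← e]; exact h2 (by omega)
  · have e : max m n = k + 1 := by omega
    have h4 := h3 (by omega)
    rw [e] at h4
    exact h4

lemma mem_L2 {a b : ℝ} (ha : 0 < a) (hb : 0 < b) {m n : ℕ} {gd : ℕ → ℝ → ℝ}
    (hg : MemH (volume.withDensity (fun x => ENNReal.ofReal (betaDensity a b x)))
      (fun x => x * (1 - x)) (Set.Ioo 0 1) m n gd)
    {i : ℕ} (hi : i ≤ n) :
    Integrable (fun t => gd i t ^ 2 * wt (a + i) (b + i) t) lam := by
  refine Nat.decreasingInduction' (P := fun i =>
    Integrable (fun t => gd i t ^ 2 * wt (a + i) (b + i) t) lam) ?_ hi ?_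
  · intro k hk _ ih
    refine hardy (mem_pair hg (lt_of_lt_of_le hk (le_max_right _ _))) (by positivity)
      (by positivity) ?_
    simpa [add_assoc] using ih
  · exact (dens_integrable_q ha hb n (fun x => gd n x ^ 2)).1 hg.2.2.2.1

lemma mem_aesm {a b : ℝ} {m n : ℕ} (hn : 1 ≤ n) {gd : ℕ → ℝ → ℝ}
    (hg : MemH (volume.withDensity (fun x => ENNReal.ofReal (betaDensity a b x)))
      (fun x => x * (1 - x)) (Set.Ioo 0 1) m n gd)
    {i : ℕ} (hi : i ≤ max m n) : AEStronglyMeasurable (gd i) lam := by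
  cases i with
  | zero =>
    exact aesm_of_cont (mem_pair hg (k := 0) (by omega)).continuousOn
  | succ i => exact (mem_pair hg (k := i) (by omega)).aesm

lemma mem_L1 {a b : ℝ} (ha : 0 < a) (hb : 0 < b) {m n : ℕ} (hn : 1 ≤ n) {gd : ℕ → ℝ → ℝ}
    (hg : MemH (volume.withDensity (fun x => ENNReal.ofReal (betaDensity a b x)))
      (fun x => x * (1 - x)) (Set.Ioo 0 1) m n gd)
    {i : ℕ} (hi : i ≤ max m n) :
    Integrable (fun t => gd i t * wt (a + i) (b + i) t) lam := by
  by_cases h : i ≤ n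
  · exact L2_L1 (mem_aesm hn hg hi) (by positivity) (by positivity) (mem_L2 ha hb hg h)
  · have h1 := (dens_integrable_q ha hb i _).1 (hg.2.2.2.2 i (by omega) (by omega))
    refine h1.mono ((mem_aesm hn hg hi).mul (wt_meas _ _).aestronglyMeasurable) ?_
    simp

lemma mem_coef {a b : ℝ} (ha : 0 < a) (hb : 0 < b) {m n : ℕ} (hn : 1 ≤ n) {gd : ℕ → ℝ → ℝ}
    (hg : MemH (volume.withDensity (fun x => ENNReal.ofReal (betaDensity a b x)))
      (fun x => x * (1 - x)) (Set.Ioo 0 1) m n gd)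
    {i : ℕ} (hi : i ≤ max m n) (k : ℕ) :
    ∫ x, gd i x * wt (a + i) (b + i) x * (JJ (a + i) (b + i) k).eval x ∂lam =
      (-1) ^ i * ∫ x, gd 0 x * wt a b x * (JJ a b (k + i)).eval x ∂lam := by
  induction i generalizing k with
  | zero => simp
  | succ i ih =>
    have h1 := mem_L1 ha hb hn hg hi
    have h2 := ih (by omega) (k + 1)
    have h3 := (ibp (mem_pair hg (k := i) (by omega)) (A := a + i) (B := b + i) (by positivity)
      (by positivity) (by simpa [add_assoc] using h1)).2 (JJ (a + i + 1) (b + i + 1) k)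
    have h4 : JJ (a + i) (b + i) (k + 1) = TT (a + i) (b + i) (JJ (a + i + 1) (b + i + 1) k) := rfl
    rw [h4, h3] at h2
    push_cast
    rw [← add_assoc, ← add_assoc, show k + (i + 1) = k + 1 + i by ring, pow_succ]
    linarith

lemma mem_hasSum {a b : ℝ} (ha : 0 < a) (hb : 0 < b) {m n : ℕ} (hn : 1 ≤ n) {gd : ℕ → ℝ → ℝ}
    (hg : MemH (volume.withDensity (fun x => ENNReal.ofReal (betaDensity a b x)))
      (fun x => x * (1 - x)) (Set.Ioo 0 1) m n gd)
    {i : ℕ} (hi : i ≤ n) :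
    HasSum (fun k : ℕ => fall k i * rise (k + (a + b) - 1) i *
        (cst a b * (∫ x, gd 0 x * wt a b x * (JJ a b k).eval x ∂lam) ^ 2 / NN a b k))
      (∫ x, x ^ i * (1 - x) ^ i * gd i x ^ 2
        ∂(volume.withDensity (fun x => ENNReal.ofReal (betaDensity a b x)))) := by
  have hi' : i ≤ max m n := hi.trans (le_max_right _ _)
  have hp := (parseval (A := a + i) (B := b + i) (by positivity) (by positivity)
    (mem_aesm hn hg hi') (mem_L2 ha hb hg hi)).mul_left (cst a b)
  rw [dens_integral_q ha hb, ← hasSum_nat_add_iff' i, Finset.sum_eq_zero, sub_zero]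
  · refine (congrArg (fun f => HasSum f _) (funext fun k => ?_)).mpr hp
    rw [mem_coef ha hb hn hg hi', NN_shift k i a b, mul_pow, ← pow_mul, mul_comm i 2, pow_mul]
    have e1 := (fall_pos (M := k + i) (k := i) (by omega)).ne'
    have e2 : rise ((k + i : ℕ) + (a + b) - 1) i ≠ 0 := by
      rcases Nat.eq_zero_or_pos i with h | h
      · subst h; simp [rise]
      · refine (rise_pos ?_ i).ne'
        have : (1 : ℝ) ≤ (k + i : ℕ) := by exact_mod_cast (by omega)
        linarith
    have e3 := (NN_pos k (A := a + i) (B := b + i) (by positivity) (by positivity)).ne'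
    field_simp
    norm_num
  · intro k hk
    rw [fall_eq_zero (Finset.mem_range.1 hk)]; simp




lemma poly_coef_zero (k : ℕ) : ∀ {A B : ℝ}, 0 < A → 0 < B → ∀ p : Polynomial ℝ, p.natDegree < k →
    ∫ x, p.eval x * wt A B x * (JJ A B k).eval x ∂lam = 0 := by
  induction k with
  | zero => intro A B _ _ p hp; omega
  | succ k ih =>
    intro A B hA hB p hp
    have h4 : JJ A B (k + 1) = TT A B (JJ (A + 1) (B + 1) k) := rfl
    rw [h4, ibp_poly hA hB, neg_eq_zero]
    rcases Nat.eq_zero_or_pos p.natDegree with h | h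
    · rw [Polynomial.derivative_of_natDegree_zero h]; simp
    · exact ih (by linarith) (by linarith) _
        (lt_of_lt_of_le (Polynomial.natDegree_derivative_lt h.ne') (by omega))

lemma isPoly_iff {A B : ℝ} (hA : 0 < A) (hB : 0 < B) {h : ℝ → ℝ}
    (hc : ContinuousOn h (Set.Ioo 0 1)) (hi : Integrable (fun x => h x * wt A B x) lam) (N : ℕ) :
    IsPolyOn h (Set.Ioo 0 1) N ↔
      ∀ k, N < k → ∫ x, h x * wt A B x * (JJ A B k).eval x ∂lam = 0 := by
  constructor
  · rintro ⟨p, hp, he⟩ k hk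
    rw [← poly_coef_zero k hA hB p (by omega)]
    exact integral_congr_ae (ae_lam fun x hx => by simp only [he x hx])
  · intro h0
    set C : ℕ → ℝ := fun k => ∫ x, h x * wt A B x * (JJ A B k).eval x ∂lam with hC
    let p : Polynomial ℝ := ∑ k ∈ Finset.range (N + 1), Polynomial.C (C k / NN A B k) * JJ A B k
    have hpd : p.natDegree ≤ N := by
      refine Polynomial.natDegree_sum_le_of_forall_le _ _ fun k hk => ?_
      refine (Polynomial.natDegree_C_mul_le _ _).trans ((JJ_deg k A B hA hB).1.trans ?_)
      have := Finset.mem_range.1 hk; omega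
    refine ⟨p, hpd, ?_⟩
    have hpi : Integrable (fun x => p.eval x * wt A B x) lam := TT_integrable hA hB p
    have hpc : ∀ l, ∫ x, p.eval x * wt A B x * (JJ A B l).eval x ∂lam =
        if l ≤ N then C l else 0 := by
      intro l
      have e : ∀ x, p.eval x * wt A B x * (JJ A B l).eval x =
          ∑ k ∈ Finset.range (N + 1), (C k / NN A B k) *
            ((JJ A B k).eval x * wt A B x * (JJ A B l).eval x) := by
        intro x
        simp only [p, Polynomial.eval_finsetSum, Polynomial.eval_mul, Polynomial.eval_C,
          Finset.sum_mul]
        exact Finset.sum_congr rfl fun k _ => by ring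
      simp only [e]
      rw [integral_finsetSum _ fun k _ =>
        (integrable_mul_poly (TT_integrable hA hB (JJ A B k)) _).const_mul _]
      simp only [integral_const_mul, JJ_orth _ _ A B hA hB, mul_ite, mul_zero,
        Finset.sum_ite_eq', Finset.mem_range, Nat.lt_succ_iff]
      split_ifs
      · exact div_mul_cancel₀ _ (NN_pos l hA hB).ne'
      · rfl
    have hd := determinacy (hi.sub hpi) (orth_all hA hB (hi.sub hpi) fun l => by
      simp only [Pi.sub_apply, sub_mul]
      rw [integral_sub (integrable_mul_poly hi _) (integrable_mul_poly hpi _), hpc]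
      split_ifs with hl
      · simp [hC]
      · rw [h0 l (by omega)]; simp)
    have hae : h =ᵐ[volume.restrict (Set.Ioo (0 : ℝ) 1)] fun x => p.eval x := by
      filter_upwards [hd, ae_restrict_mem measurableSet_Ioo] with x hx hx2
      have := wt_pos A B hx2
      simp only [Pi.sub_apply, Pi.zero_apply, ← sub_mul] at hx
      have := (mul_eq_zero.1 hx).resolve_right this.ne'
      linarith
    exact Measure.eqOn_open_of_ae_eq hae isOpen_Ioo hc p.continuous.continuousOn

lemma first_term {a b : ℝ} (ha : 0 < a) (hb : 0 < b) {m n i : ℕ} (hi1 : 1 ≤ i) (hi : i ≤ m)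
    (D : ℝ) :
    ((m.choose i : ℝ) * rise (a + b + m + i) n * rise (a + b) (2 * i) /
          (fall ((m : ℝ) + n) i * rise a i * rise b i * rise (a + b + i - 1) i *
            rise (a + b + m) n)) * (cst a b * ((-1) ^ i * D)) ^ 2 =
      rho (a + b) m n (pt (a + b) i) * (cst a b * D ^ 2 / NN a b i) := by
  have hs : 0 < a + b := by positivity
  have h1 := NN_shift 0 i a b
  have h2 := cst_wt ha hb
  have h3 := wt_int_shift ha hb i
  have hi1' : (1 : ℝ) ≤ i := by exact_mod_cast hi1
  rw [rho_small hs hi, fall_choose]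
  have hN : NN (a + i) (b + i) 0 = ∫ x, wt (a + i) (b + i) x ∂lam := rfl
  simp only [zero_add] at h1
  rw [show (i : ℝ) + (a + b) - 1 = a + b + i - 1 by ring, hN, h3] at h1
  rw [h1]
  have p1 := (rise_pos ha i).ne'
  have p2 := (rise_pos hb i).ne'
  have p3 := (rise_pos hs (2 * i)).ne'
  have p4 := (rise_pos (x := a + b + i - 1) (by linarith) i).ne'
  have p5 := (rise_pos (x := a + b + m) (by positivity) n).ne'
  have p6 : fall ((m : ℝ) + n) i ≠ 0 := by
    have := (fall_pos (M := m + n) (k := i) (by omega)).ne'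
    simpa using this
  have p7 := (fall_pos (le_refl i)).ne'
  have p8 := (wt_int_pos ha hb).ne'
  have hc : cst a b = 1 / ∫ x, wt a b x ∂lam := by field_simp; exact h2
  rw [hc]
  have hsq : ((-1 : ℝ) ^ i) ^ 2 = 1 := by rw [← pow_mul, mul_comm, pow_mul]; norm_num
  rw [mul_pow, mul_pow, hsq]
  field_simp

theorem beta_variance_bound
    (a b : ℝ) (ha : 0 < a) (hb : 0 < b) (P : Measure ℝ)
    (hP : P = volume.withDensity (fun x => ENNReal.ofReal (betaDensity a b x)))
    (m n : ℕ) (hn : 1 ≤ n) (gd : ℕ → ℝ → ℝ)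
    (hg : MemH P (fun x => x * (1 - x)) (Set.Ioo 0 1) m n gd) :
    0 ≤ (-1 : ℝ) ^ n * (variance (gd 0) P - SbetaBound P a b m n gd) ∧
      (variance (gd 0) P = SbetaBound P a b m n gd ↔
        IsPolyOn (gd 0) (Set.Ioo 0 1) (m + n)) := by
  subst hP
  have hs : 0 < a + b := by positivity
  have hprob := isProb ha hb
  set C : ℕ → ℝ := fun k => ∫ x, gd 0 x * wt a b x * (JJ a b k).eval x ∂lam with hC
  set d : ℕ → ℝ := fun k => cst a b * C k ^ 2 / NN a b k with hd
  set P := volume.withDensity (fun x => ENNReal.ofReal (betaDensity a b x)) with hPdef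
  have hcont : ContinuousOn (gd 0) (Set.Ioo 0 1) := (mem_pair hg (k := 0) (by omega)).continuousOn
  have hL1 : Integrable (fun x => gd 0 x * wt a b x) lam := by
    simpa using mem_L1 ha hb hn hg (i := 0) (by omega)
  have hL2 : Integrable (fun x => gd 0 x ^ 2 * wt a b x) lam := by
    simpa using mem_L2 ha hb hg (i := 0) (by omega)
  have hL1P : Integrable (gd 0) P := (dens_integrable ha hb _).2 hL1
  have hL2P : Integrable (fun x => gd 0 x ^ 2) P := (dens_integrable ha hb _).2 hL2
  have hvar : variance (gd 0) P = ∫ x, gd 0 x ^ 2 ∂P - (∫ x, gd 0 x ∂P) ^ 2 := by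
    have h := variance_eq_sub (μ := P) ((memLp_two_iff_integrable_sq hL1P.1).2 hL2P)
    simpa using h
  have hd0 : (∫ x, gd 0 x ∂P) ^ 2 = d 0 := by
    have h2 := cst_wt ha hb
    have p8 := (wt_int_pos ha hb).ne'
    have hN : NN a b 0 = ∫ x, wt a b x ∂lam := rfl
    have hc : cst a b = 1 / ∫ x, wt a b x ∂lam := by field_simp; exact h2
    have hJ : JJ a b 0 = 1 := rfl
    rw [hPdef, dens_integral ha hb]
    simp only [hd, hC, hN, hJ, Polynomial.eval_one, mul_one]
    rw [hc]
    field_simp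
  set E : ℕ → ℝ := fun i => ∫ x, x ^ i * (1 - x) ^ i * gd i x ^ 2 ∂P with hE
  have hsum : HasSum (fun k : ℕ => rho (a + b) m n (pt (a + b) k) * d k)
      (∑ i ∈ Finset.range (n + 1), ac (a + b) m n i * E i) := by
    have h := hasSum_sum (s := Finset.range (n + 1)) (fun i hi =>
      (mem_hasSum ha hb hn hg (i := i) (by have := Finset.mem_range.1 hi; omega)).mul_left
        (ac (a + b) m n i))
    refine (congrArg (fun f => HasSum f _) (funext fun k => ?_)).mpr h
    rw [← saal hs, Finset.sum_mul]
    refine Finset.sum_congr rfl fun i _ => ?_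
    rw [prod_kappa]
    simp only [hd, hC]
    ring
  have hacE : ∑ i ∈ Finset.range (n + 1), ac (a + b) m n i * E i =
      ∫ x, gd 0 x ^ 2 ∂P - ∑ i ∈ Finset.Icc 1 n,
      (-1 : ℝ) ^ (i - 1) *
          ((n.choose i : ℝ) / (fall ((m : ℝ) + n) i * rise (a + b + m) i)) * E i := by
    rw [Finset.sum_range_succ', Finset.range_eq_Ico, Finset.sum_Ico_add' (fun i => ac (a + b) m n i * E i) 0 n 1,
      zero_add, sub_eq_neg_add, ← Finset.sum_neg_distrib]
    congr 1
    · refine Finset.sum_congr (by ext; simp [Finset.mem_Ico, Finset.mem_Icc]) fun i hi => ?_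
      have h1 : 1 ≤ i := (Finset.mem_Icc.1 hi).1
      obtain ⟨j, rfl⟩ : ∃ j, i = j + 1 := ⟨i - 1, by omega⟩
      simp only [ac, Nat.add_sub_cancel, pow_succ]
      ring
    · simp [ac, fall, rise, hE]
  have hsm : ∑ k ∈ Finset.range (m + 1), rho (a + b) m n (pt (a + b) k) * d k =
      (∫ x, gd 0 x ∂P) ^ 2 + ∑ i ∈ Finset.Icc 1 m,
      ((m.choose i : ℝ) * rise (a + b + m + i) n * rise (a + b) (2 * i) /
          (fall ((m : ℝ) + n) i * rise a i * rise b i * rise (a + b + i - 1) i *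
            rise (a + b + m) n)) *
        (∫ x, x ^ i * (1 - x) ^ i * gd i x ∂P) ^ 2 := by
    rw [Finset.sum_range_succ', Finset.range_eq_Ico,
      Finset.sum_Ico_add' (fun i : ℕ => rho (a + b) m n (pt (a + b) i) * d i) 0 m 1,
      zero_add, add_comm]
    congr 1
    · rw [hd0]
      simp [rho, pt]
    · refine Finset.sum_congr (by ext; simp [Finset.mem_Ico, Finset.mem_Icc]) fun i hi => ?_
      have h1 := Finset.mem_Icc.1 hi
      have h2 := mem_coef ha hb hn hg (i := i) (by omega) 0
      have hJ : JJ (a + i) (b + i) 0 = 1 := rfl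
      simp only [hJ, Polynomial.eval_one, mul_one, zero_add] at h2
      rw [hPdef, dens_integral_q ha hb, h2, first_term ha hb h1.1 h1.2]
  have hfin : HasSum (fun k : ℕ => rho (a + b) m n (pt (a + b) (k + (m + 1) : ℕ)) * d (k + (m + 1)))
      (variance (gd 0) P - SbetaBound P a b m n gd) := by
    have h := (hasSum_nat_add_iff' (m + 1)).2 hsum
    rw [hsm, hacE] at h
    refine (congrArg (fun v => HasSum _ v) ?_).mpr h
    rw [hvar, SbetaBound]
    ring
  have hfin2 := hfin.mul_left ((-1 : ℝ) ^ n)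
  have hdn : ∀ k, 0 ≤ d k := fun k =>
    div_nonneg (mul_nonneg (cst_pos ha hb).le (sq_nonneg _)) (NN_pos k ha hb).le
  have hnn : ∀ k : ℕ, 0 ≤ (-1 : ℝ) ^ n *
      (rho (a + b) m n (pt (a + b) (k + (m + 1) : ℕ)) * d (k + (m + 1))) := by
    intro k
    by_cases hk : k + (m + 1) ≤ m + n
    · rw [rho_zero hs (by omega) hk]; simp
    · rw [← mul_assoc]
      exact mul_nonneg (rho_sign hs (by omega)).le (hdn _)
  refine ⟨hfin2.nonneg hnn, ?_⟩
  rw [isPoly_iff ha hb hcont hL1]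
  have hn1 : ((-1 : ℝ) ^ n) ≠ 0 := by positivity
  have hd_iff : ∀ k, d k = 0 ↔ C k = 0 := by
    intro k
    have := (cst_pos ha hb).ne'
    have := (NN_pos k ha hb).ne'
    simp [*]
  constructor
  · intro heq k hk
    rw [heq, sub_self, mul_zero, hasSum_zero_iff_of_nonneg hnn] at hfin2
    have h := congrFun hfin2 (k - (m + 1))
    rw [show k - (m + 1) + (m + 1) = k by omega, ← mul_assoc] at h
    exact (hd_iff k).1 ((mul_eq_zero.1 h).resolve_left (rho_sign hs hk).ne')
  · intro h0
    have hz : ∀ k : ℕ, rho (a + b) m n (pt (a + b) (k + (m + 1) : ℕ)) * d (k + (m + 1)) = 0 := by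
      intro k
      by_cases hk : k + (m + 1) ≤ m + n
      · rw [rho_zero hs (by omega) hk]; simp
      · rw [(hd_iff _).2 (h0 _ (by omega)), mul_zero]
    simp only [hz] at hfin
    have := hfin.unique hasSum_zero
    linarith


end
end

section
/- Let Z be a standard normal random variable and let g : ℝ → ℝ be absolutely continuous with a.e. derivative g′ satisfying E[(g′(Z))²] < ∞. Then Var[g(Z)] ≤ E[(g′(Z))²], with equality if and only if g is a polynomial of degree at most one (an affine function). -/
open MeasureTheory ProbabilityTheory Finset Filter

noncomputable section

/-- The standard normal density. -/
def chPhi (x : ℝ) : ℝ := (Real.sqrt (2 * Real.pi))⁻¹ * Real.exp (-x ^ 2 / 2)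

lemma chPhi_pos (x : ℝ) : 0 < chPhi x := by unfold chPhi; positivity

lemma chPhi_cont : Continuous chPhi := by unfold chPhi; fun_prop

lemma chPhi_neg (x : ℝ) : chPhi (-x) = chPhi x := by simp [chPhi]

lemma chPhi_deriv (x : ℝ) : HasDerivAt (fun x => -chPhi x) (x * chPhi x) x := by
  unfold chPhi
  have h1 : HasDerivAt (fun x : ℝ => -x ^ 2 / 2) (-x) x := by
    have := ((hasDerivAt_pow 2 x).neg).div_const 2
    refine this.congr_deriv ?_
    norm_num
    ring
  refine ((h1.exp).const_mul (Real.sqrt (2 * Real.pi))⁻¹).neg.congr_deriv ?_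
  ring

lemma chPhi_tendsto : Tendsto (fun x => -chPhi x) atTop (nhds 0) := by
  have h1 : Tendsto (fun x : ℝ => -x ^ 2 / 2) atTop atBot := by
    have : Tendsto (fun x : ℝ => x ^ 2) atTop atTop := tendsto_pow_atTop (by norm_num)
    have h2 := (this.atTop_div_const (show (0:ℝ) < 2 by norm_num))
    have h3 := tendsto_neg_atTop_atBot.comp h2
    refine h3.congr fun x => ?_
    simp [neg_div]
  have h2 := (Real.tendsto_exp_atBot.comp h1).const_mul (-(Real.sqrt (2 * Real.pi))⁻¹)
  simpa [chPhi, Function.comp_def] using h2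

lemma chPhi_lint_Ioi (t : ℝ) (ht : 0 ≤ t) :
    ∫⁻ x in Set.Ioi t, ENNReal.ofReal (|x| * chPhi x) = ENNReal.ofReal (chPhi t) := by
  have hpos : ∀ x ∈ Set.Ioi t, 0 ≤ x * chPhi x := fun x hx =>
    mul_nonneg (ht.trans (le_of_lt hx)) (chPhi_pos x).le
  have h1 := integral_Ioi_of_hasDerivAt_of_nonneg' (fun x _ => chPhi_deriv x) hpos chPhi_tendsto
  have h2 := integrableOn_Ioi_deriv_of_nonneg' (fun x _ => chPhi_deriv x) hpos chPhi_tendsto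
  have h3 := ofReal_integral_eq_lintegral_ofReal h2
    ((ae_restrict_iff' measurableSet_Ioi).2 (Eventually.of_forall hpos))
  rw [h1] at h3
  rw [show chPhi t = 0 - -chPhi t by ring, h3]
  refine setLIntegral_congr_fun measurableSet_Ioi fun x hx => ?_
  rw [abs_of_nonneg (ht.trans (le_of_lt hx))]

lemma chPhi_lint_Iio (t : ℝ) (ht : t ≤ 0) :
    ∫⁻ x in Set.Iio t, ENNReal.ofReal (|x| * chPhi x) = ENNReal.ofReal (chPhi t) := by
  rw [← chPhi_neg t, ← chPhi_lint_Ioi (-t) (by linarith)]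
  have := (Measure.measurePreserving_neg (volume : Measure ℝ)).setLIntegral_comp_preimage_emb
    (MeasurableEquiv.neg ℝ).measurableEmbedding
    (fun x => ENNReal.ofReal (|x| * chPhi x)) (Set.Ioi (-t))
  rw [← this]
  have hs : Neg.neg ⁻¹' Set.Ioi (-t) = Set.Iio t := by ext x; simp
  rw [hs]
  simp [chPhi_neg]

/-- The kernel region. -/
def chS : Set (ℝ × ℝ) := {p | (0 < p.2 ∧ p.2 ≤ p.1) ∨ (p.1 < p.2 ∧ p.2 ≤ 0)}

lemma chS_meas : MeasurableSet chS := by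
  unfold chS
  refine MeasurableSet.union (MeasurableSet.inter ?_ ?_) (MeasurableSet.inter ?_ ?_)
  · exact measurableSet_lt measurable_const measurable_snd
  · exact measurableSet_le measurable_snd measurable_fst
  · exact measurableSet_lt measurable_fst measurable_snd
  · exact measurableSet_le measurable_snd measurable_const

lemma chS_iff (x t : ℝ) : (x, t) ∈ chS ↔ t ∈ Set.uIoc 0 x := by
  simp only [chS, Set.mem_ofPred_eq, Set.mem_uIoc]

lemma ch_inner (t : ℝ) : ∫⁻ x, chS.indicator (fun p => ENNReal.ofReal (|p.1| * chPhi p.1)) (x, t)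
    = ENNReal.ofReal (chPhi t) := by
  rcases lt_or_ge 0 t with ht | ht
  · rw [← chPhi_lint_Ioi t ht.le, ← setLIntegral_congr (Ioi_ae_eq_Ici (a := t)).symm,
      ← lintegral_indicator measurableSet_Ici]
    refine lintegral_congr fun x => ?_
    simp only [Set.indicator, chS, Set.mem_ofPred_eq, Set.mem_Ici]
    congr 1
    simp [ht, not_le.2 ht]
  · rw [← chPhi_lint_Iio t ht, ← lintegral_indicator measurableSet_Iio]
    refine lintegral_congr fun x => ?_
    simp only [Set.indicator, chS, Set.mem_ofPred_eq, Set.mem_Iio]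
    congr 1
    simp [ht, not_lt.2 ht]

lemma ch_tonelli (f : ℝ → ENNReal) (hf : Measurable f) :
    ∫⁻ x, ENNReal.ofReal (|x| * chPhi x) * ∫⁻ t in Set.uIoc 0 x, f t
      = ∫⁻ t, ENNReal.ofReal (chPhi t) * f t := by
  have hm : Measurable (fun p : ℝ × ℝ => ENNReal.ofReal (|p.1| * chPhi p.1)) := by
    have := chPhi_cont
    fun_prop
  calc _ = ∫⁻ x, ∫⁻ t, chS.indicator (fun p => ENNReal.ofReal (|p.1| * chPhi p.1)) (x, t) * f t := by
        refine lintegral_congr fun x => ?_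
        rw [← lintegral_indicator measurableSet_uIoc, ← lintegral_const_mul _
          (hf.indicator measurableSet_uIoc)]
        refine lintegral_congr fun t => ?_
        by_cases h : t ∈ Set.uIoc 0 x
        · have h' := (chS_iff x t).2 h
          simp [h, h']
        · have h' : (x, t) ∉ chS := fun h' => h ((chS_iff x t).1 h')
          simp [h, h']
    _ = ∫⁻ t, ∫⁻ x, chS.indicator (fun p => ENNReal.ofReal (|p.1| * chPhi p.1)) (x, t) * f t := by
        refine lintegral_lintegral_swap ?_
        exact ((hm.indicator chS_meas).mul (hf.comp measurable_snd)).aemeasurable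
    _ = _ := by
        refine lintegral_congr fun t => ?_
        rw [lintegral_mul_const, ch_inner]
        exact (hm.indicator chS_meas).comp (measurable_id.prodMk measurable_const)

/-- Square of the derivative is integrable on bounded intervals. -/
lemma ch_sq_int (f : ℝ → ℝ) (hf : Integrable (fun x => chPhi x * f x ^ 2))
    (a b : ℝ) : IntervalIntegrable (fun x => f x ^ 2) volume a b := by
  have h1 : IntervalIntegrable (fun x => chPhi x * f x ^ 2) volume a b := hf.intervalIntegrable
  have h2 : ContinuousOn (fun x => (chPhi x)⁻¹) (Set.uIcc a b) :=
    (chPhi_cont.inv₀ fun x => (chPhi_pos x).ne').continuousOn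
  have h3 := h1.continuousOn_mul h2
  refine h3.congr fun x _ => ?_
  have := (chPhi_pos x).ne'
  field_simp

/-- Defect identity in the Cauchy-Schwarz inequality. -/
lemma ch_defect (f : ℝ → ℝ) (x : ℝ) (hx : x ≠ 0) (h1 : IntervalIntegrable f volume 0 x)
    (h2 : IntervalIntegrable (fun t => f t ^ 2) volume 0 x) (m : ℝ)
    (hm : m = (∫ t in (0:ℝ)..x, f t) / x) :
    x * (∫ t in (0:ℝ)..x, f t ^ 2) - (∫ t in (0:ℝ)..x, f t) ^ 2
      = x * ∫ t in (0:ℝ)..x, (f t - m) ^ 2 := by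
  have e : ∀ t, (f t - m) ^ 2 = f t ^ 2 - (2 * m) * f t + m ^ 2 := fun t => by ring
  simp_rw [e]
  rw [intervalIntegral.integral_add (h2.sub (h1.const_mul _)) (by simp),
    intervalIntegral.integral_sub h2 (h1.const_mul _), intervalIntegral.integral_const_mul,
    intervalIntegral.integral_const]
  subst hm
  simp only [smul_eq_mul, sub_zero]
  field_simp
  ring

lemma ch_mul_interval (f : ℝ → ℝ) (x : ℝ) :
    x * ∫ t in (0:ℝ)..x, f t = |x| * ∫ t in Set.uIoc 0 x, f t := by
  rcases le_total 0 x with h | h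
  · rw [intervalIntegral.integral_of_le h, Set.uIoc_of_le h, abs_of_nonneg h]
  · rw [intervalIntegral.integral_of_ge h, Set.uIoc_of_ge h, abs_of_nonpos h]; ring

lemma ch_defect_nonneg (f : ℝ → ℝ) (x : ℝ) (h1 : IntervalIntegrable f volume 0 x)
    (h2 : IntervalIntegrable (fun t => f t ^ 2) volume 0 x) :
    0 ≤ x * (∫ t in (0:ℝ)..x, f t ^ 2) - (∫ t in (0:ℝ)..x, f t) ^ 2 := by
  rcases eq_or_ne x 0 with rfl | hx
  · simp
  · rw [ch_defect f x hx h1 h2 _ rfl, ch_mul_interval]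
    exact mul_nonneg (abs_nonneg _) (integral_nonneg fun t => sq_nonneg _)

lemma ch_defect_zero (f : ℝ → ℝ) (x : ℝ) (hx : x ≠ 0) (h1 : IntervalIntegrable f volume 0 x)
    (h2 : IntervalIntegrable (fun t => f t ^ 2) volume 0 x)
    (h0 : x * (∫ t in (0:ℝ)..x, f t ^ 2) - (∫ t in (0:ℝ)..x, f t) ^ 2 = 0)
    (y : ℝ) (hy : y ∈ Set.uIcc 0 x) :
    ∫ t in (0:ℝ)..y, f t = y * ((∫ t in (0:ℝ)..x, f t) / x) := by
  set m := (∫ t in (0:ℝ)..x, f t) / x with hm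
  rw [ch_defect f x hx h1 h2 m hm, ch_mul_interval] at h0
  have h3 : ∫ t in Set.uIoc 0 x, (f t - m) ^ 2 = 0 := by
    rcases mul_eq_zero.1 h0 with h | h
    · exact absurd (abs_eq_zero.1 h) hx
    · exact h
  have hi : IntervalIntegrable (fun t => (f t - m) ^ 2) volume 0 x := by
    have e : (fun t => (f t - m) ^ 2) = fun t => f t ^ 2 - (2 * m) * f t + m ^ 2 := by
      ext t; ring
    rw [e]
    exact (h2.sub (h1.const_mul _)).add (by simp)
  have h4 := (setIntegral_eq_zero_iff_of_nonneg_ae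
    (Eventually.of_forall fun t => sq_nonneg (f t - m)) hi.def').1 h3
  have h5 : ∀ᵐ t, t ∈ Set.uIoc 0 x → f t = m := by
    have := (ae_restrict_iff' measurableSet_uIoc).1 h4
    filter_upwards [this] with t ht htx
    have := ht htx
    simp only [Pi.zero_apply] at this
    have := pow_eq_zero_iff (two_ne_zero) |>.1 this
    linarith
  have h6 : ∫ t in (0:ℝ)..y, f t = ∫ t in (0:ℝ)..y, m := by
    refine intervalIntegral.integral_congr_ae ?_
    filter_upwards [h5] with t ht hty
    refine ht ?_
    rw [Set.mem_uIcc] at hy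
    rw [Set.mem_uIoc] at hty ⊢
    rcases hy with hy | hy <;> rcases hty with h | h
    · left; constructor <;> linarith
    · exfalso; linarith
    · exfalso; linarith
    · right; constructor <;> linarith
  rw [h6, intervalIntegral.integral_const]
  simp

lemma ch_loc (f : ℝ → ℝ) (hf : ∀ a b : ℝ, IntervalIntegrable f volume a b) :
    LocallyIntegrable f volume := by
  rw [locallyIntegrable_iff]
  intro k hk
  rcases k.eq_empty_or_nonempty with rfl | hne
  · simp
  have hsub := hk.isBounded.subset_Icc_sInf_sSup
  obtain ⟨x, hx⟩ := hne
  have hle := (hsub hx).1.trans (hsub hx).2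
  exact ((intervalIntegrable_iff_integrableOn_Icc_of_le hle).1 (hf _ _)).mono_set hsub

/-- Tonelli step in real form. -/
lemma ch_key (P : Measure ℝ)
    (hP : P = volume.withDensity (fun x => ENNReal.ofReal (chPhi x)))
    (f : ℝ → ℝ) (hf : Measurable f) (hint : Integrable (fun x => (f x) ^ 2) P)
    (h2 : ∀ a b, IntervalIntegrable (fun x => f x ^ 2) volume a b) :
    Integrable (fun x => x * ∫ t in (0:ℝ)..x, f t ^ 2) P ∧
      ∫ x, (x * ∫ t in (0:ℝ)..x, f t ^ 2) ∂P = ∫ x, f x ^ 2 ∂P := by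
  have hφ : Measurable (fun x => ENNReal.ofReal (chPhi x)) := by
    have := chPhi_cont
    fun_prop
  have hc : Continuous (fun x => x * ∫ t in (0:ℝ)..x, f t ^ 2) :=
    continuous_id.mul (intervalIntegral.continuous_primitive h2 0)
  have hnn : ∀ x, 0 ≤ x * ∫ t in (0:ℝ)..x, f t ^ 2 := fun x => by
    rw [ch_mul_interval (fun t => f t ^ 2)]
    exact mul_nonneg (abs_nonneg _) (integral_nonneg fun t => sq_nonneg _)
  have hl : ∫⁻ x, ENNReal.ofReal (x * ∫ t in (0:ℝ)..x, f t ^ 2) ∂P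
      = ∫⁻ x, ENNReal.ofReal (f x ^ 2) ∂P := by
    rw [hP, lintegral_withDensity_eq_lintegral_mul _ hφ hc.measurable.ennreal_ofReal,
      lintegral_withDensity_eq_lintegral_mul _ hφ (hf.pow_const 2).ennreal_ofReal]
    simp only [Pi.mul_apply]
    rw [← ch_tonelli _ (hf.pow_const 2).ennreal_ofReal]
    refine lintegral_congr fun x => ?_
    rw [ch_mul_interval (fun t => f t ^ 2), ENNReal.ofReal_mul (abs_nonneg _),
      ENNReal.ofReal_mul (abs_nonneg _),
      ofReal_integral_eq_lintegral_ofReal (h2 0 x).def' (Eventually.of_forall fun t => sq_nonneg _)]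
    ring
  constructor
  · refine ⟨hc.aestronglyMeasurable, ?_⟩
    rw [hasFiniteIntegral_iff_ofReal (Eventually.of_forall hnn), hl,
      ← hasFiniteIntegral_iff_ofReal (Eventually.of_forall fun t => sq_nonneg (f t))]
    exact hint.2
  · rw [integral_eq_lintegral_of_nonneg_ae (Eventually.of_forall hnn) hc.aestronglyMeasurable, hl,
      ← integral_eq_lintegral_of_nonneg_ae (Eventually.of_forall fun t => sq_nonneg (f t))
        hint.1]

lemma ch_gauss : volume.withDensity (fun x => ENNReal.ofReal (chPhi x)) = gaussianReal 0 1 := by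
  rw [gaussianReal_of_var_ne_zero _ one_ne_zero]
  congr 1
  ext x
  simp [gaussianPDF, gaussianPDFReal, chPhi]

lemma ch_main (P : Measure ℝ)
    (hP : P = volume.withDensity (fun x => ENNReal.ofReal (chPhi x)))
    (g f : ℝ → ℝ) (hf : Measurable f)
    (hAC : ∀ a b : ℝ, IntervalIntegrable f volume a b ∧ g b - g a = ∫ t in a..b, f t)
    (hint : Integrable (fun x => (f x) ^ 2) P) :
    variance g P ≤ (∫ x, (f x) ^ 2 ∂P) ∧
      (variance g P = (∫ x, (f x) ^ 2 ∂P) ↔ IsPolyOn g Set.univ 1) := by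
  have hφ : Measurable (fun x => ENNReal.ofReal (chPhi x)) := by
    have := chPhi_cont
    fun_prop
  have hPg : P = gaussianReal 0 1 := hP.trans ch_gauss
  have hprob : IsProbabilityMeasure P := by rw [hPg]; infer_instance
  have hac : volume ≪ P := by rw [hPg]; exact gaussianReal_absolutelyContinuous' 0 one_ne_zero
  have hac' : P ≪ volume := by rw [hPg]; exact gaussianReal_absolutelyContinuous 0 one_ne_zero
  have hidL : MemLp (fun x : ℝ => x) 2 P := by
    rw [hPg]; exact memLp_id_gaussianReal 2
  have hid : Integrable (fun x : ℝ => x) P := hidL.integrable (by norm_num)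
  have hid0 : ∫ x, x ∂P = 0 := by rw [hPg, integral_id_gaussianReal]
  have hvar : variance (fun x : ℝ => x) P = 1 := by
    rw [hPg]; exact (variance_id_gaussianReal (μ := 0) (v := 1)).trans (by simp)
  have hvol : Integrable (fun x => chPhi x * f x ^ 2) := by
    have := hint
    rw [hP, integrable_withDensity_iff hφ (by simp)] at this
    refine this.congr (Eventually.of_forall fun x => ?_)
    simp only
    rw [ENNReal.toReal_ofReal (chPhi_pos x).le, mul_comm]
  have h2 := ch_sq_int f hvol
  obtain ⟨hKi, hKe⟩ := ch_key P hP f hf hint h2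
  set K : ℝ → ℝ := fun x => x * ∫ t in (0:ℝ)..x, f t ^ 2 with hK
  set h : ℝ → ℝ := fun x => ∫ t in (0:ℝ)..x, f t with hh
  have hgh : ∀ x, g x = h x + g 0 := fun x => by
    have := (hAC 0 x).2
    simp only [hh]; linarith
  have hKc : Continuous K := continuous_id.mul (intervalIntegral.continuous_primitive h2 0)
  have hhc : Continuous h := intervalIntegral.continuous_primitive (fun a b => (hAC a b).1) 0
  have hD : ∀ x, 0 ≤ K x - h x ^ 2 := fun x => ch_defect_nonneg f x (hAC 0 x).1 (h2 0 x)
  have hh2 : Integrable (fun x => h x ^ 2) P := by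
    refine hKi.mono' (hhc.pow 2).aestronglyMeasurable (Eventually.of_forall fun x => ?_)
    rw [Real.norm_of_nonneg (sq_nonneg _)]
    linarith [hD x]
  have hhL : MemLp h 2 P := (memLp_two_iff_integrable_sq hhc.aestronglyMeasurable).2 hh2
  have hhi : Integrable h P := hhL.integrable (by norm_num)
  have hvg : variance g P = ∫ x, h x ^ 2 ∂P - (∫ x, h x ∂P) ^ 2 := by
    have : g = fun x => h x + g 0 := funext hgh
    rw [this, variance_add_const hhc.aestronglyMeasurable, variance_eq_sub hhL]
    rfl
  have hDi : Integrable (fun x => K x - h x ^ 2) P := hKi.sub hh2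
  have hgap : ∫ x, f x ^ 2 ∂P - variance g P
      = ∫ x, (K x - h x ^ 2) ∂P + (∫ x, h x ∂P) ^ 2 := by
    rw [integral_sub hKi hh2, hKe, hvg]; ring
  have hDnn : 0 ≤ ∫ x, (K x - h x ^ 2) ∂P := integral_nonneg hD
  refine ⟨by nlinarith [sq_nonneg (∫ x, h x ∂P)], ?_, ?_⟩
  · intro heq
    have hz1 : ∫ x, (K x - h x ^ 2) ∂P = 0 := by nlinarith [sq_nonneg (∫ x, h x ∂P)]
    have hz2 : ∫ x, h x ∂P = 0 := by
      have : (∫ x, h x ∂P) ^ 2 = 0 := by nlinarith [sq_nonneg (∫ x, h x ∂P)]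
      exact pow_eq_zero_iff two_ne_zero |>.1 this
    have hae := (integral_eq_zero_iff_of_nonneg hD hDi).1 hz1
    have hae' : (fun x => K x - h x ^ 2) =ᵐ[volume] fun _ => 0 := hac.ae_le hae
    have hall := (Continuous.ae_eq_iff_eq volume (hKc.sub (hhc.pow 2)) continuous_const).1 hae'
    have hlin : ∀ x y, x ≠ 0 → y ∈ Set.uIcc 0 x → h y = y * (h x / x) := fun x y hx hy =>
      ch_defect_zero f x hx (hAC 0 x).1 (h2 0 x) (congrFun hall x) y hy
    have hp : ∀ x, 0 ≤ x → h x = x * h 1 := by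
      intro x hx
      rcases le_total x 1 with h1 | h1
      · have := hlin 1 x one_ne_zero (Set.mem_uIcc.2 (Or.inl ⟨hx, h1⟩))
        simpa using this
      · have hx0 : x ≠ 0 := by linarith
        have := hlin x 1 hx0 (Set.mem_uIcc.2 (Or.inl ⟨zero_le_one, h1⟩))
        rw [this]; field_simp
    have hn : ∀ x, x ≤ 0 → h x = -x * h (-1) := by
      intro x hx
      rcases le_total (-1) x with h1 | h1
      · have := hlin (-1) x (by norm_num) (Set.mem_uIcc.2 (Or.inr ⟨h1, hx⟩))
        rw [this]; ring
      · have hx0 : x ≠ 0 := by linarith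
        have := hlin x (-1) hx0 (Set.mem_uIcc.2 (Or.inr ⟨h1, by norm_num⟩))
        rw [this]; field_simp
    have hform : ∀ x, h x = (h 1 - h (-1)) / 2 * x + (h 1 + h (-1)) / 2 * |x| := by
      intro x
      rcases le_total 0 x with hx | hx
      · rw [hp x hx, abs_of_nonneg hx]; ring
      · rw [hn x hx, abs_of_nonpos hx]; ring
    have hE : (h 1 + h (-1)) / 2 * ∫ x, |x| ∂P = 0 := by
      have : ∫ x, h x ∂P = ∫ x, ((h 1 - h (-1)) / 2 * x + (h 1 + h (-1)) / 2 * |x|) ∂P :=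
        integral_congr_ae (Eventually.of_forall hform)
      rw [integral_add (hid.const_mul _) (hid.abs.const_mul _), integral_const_mul,
        integral_const_mul, hid0, hz2] at this
      linarith
    have habs : ∫ x, |x| ∂P ≠ 0 := by
      intro h0
      have h3 := (integral_eq_zero_iff_of_nonneg (fun x : ℝ => abs_nonneg x) hid.abs).1 h0
      have h4 : (fun x : ℝ => |x|) =ᵐ[volume] fun _ => 0 := hac.ae_le h3
      have h5 := (Continuous.ae_eq_iff_eq volume continuous_abs continuous_const).1 h4
      have := congrFun h5 1
      simp at this
    have hs : (h 1 + h (-1)) / 2 = 0 := (mul_eq_zero.1 hE).resolve_right habs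
    refine ⟨Polynomial.C ((h 1 - h (-1)) / 2) * Polynomial.X + Polynomial.C (g 0),
      Polynomial.natDegree_linear_le, fun x _ => ?_⟩
    rw [hgh x, hform x, hs]
    simp
  · rintro ⟨p, hp, hpg⟩
    obtain ⟨a, b, rfl⟩ := Polynomial.exists_eq_X_add_C_of_natDegree_le_one hp
    have hg : ∀ x, g x = a * x + b := fun x => by simpa using hpg x trivial
    have hgf : g = fun x => a * x + b := funext hg
    have hloc : LocallyIntegrable f volume := ch_loc f fun a b => (hAC a b).1
    have hfa : ∀ᵐ x, f x = a := by
      filter_upwards [LocallyIntegrable.ae_hasDerivAt_integral hloc] with x hx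
      have h3 := hx 0
      have h4 : (fun x => ∫ t in (0:ℝ)..x, f t) = fun x => a * x := by
        ext y
        rw [← (hAC 0 y).2, hg, hg]; ring
      rw [h4] at h3
      have h5 := (hasDerivAt_id x).const_mul a
      simpa using h3.unique h5
    have h6 : ∫ x, f x ^ 2 ∂P = a ^ 2 := by
      have : ∫ x, f x ^ 2 ∂P = ∫ x, a ^ 2 ∂P := by
        refine integral_congr_ae ?_
        filter_upwards [hac'.ae_le hfa] with x hx
        rw [hx]
      rw [this]; simp
    rw [h6, hgf, variance_add_const (hid.const_mul a).1, variance_const_mul, hvar, mul_one]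

/-- **Chernoff's inequality.** If `Z` is standard normal and `g` is absolutely
continuous with a.e. derivative `g'` (encoded via the fundamental theorem of
calculus) such that `E (g'(Z))² < ∞`, then `Var g(Z) ≤ E (g'(Z))²`, with
equality iff `g` is a polynomial of degree at most one. -/
theorem chernoff_inequality
    (P : Measure ℝ)
    (hP : P = volume.withDensity (fun x =>
      ENNReal.ofReal ((Real.sqrt (2 * Real.pi))⁻¹ * Real.exp (-x ^ 2 / 2))))
    (g g' : ℝ → ℝ)
    (hAC : ∀ a b : ℝ, IntervalIntegrable g' volume a b ∧ g b - g a = ∫ t in a..b, g' t)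
    (hint : Integrable (fun x => (g' x) ^ 2) P) :
    variance g P ≤ (∫ x, (g' x) ^ 2 ∂P) ∧
      (variance g P = (∫ x, (g' x) ^ 2 ∂P) ↔ IsPolyOn g Set.univ 1) := by
  have hP' : P = volume.withDensity (fun x => ENNReal.ofReal (chPhi x)) := hP
  have hac : P ≪ volume := by rw [hP']; exact withDensity_absolutelyContinuous _ _
  have hloc : LocallyIntegrable g' volume := ch_loc g' fun a b => (hAC a b).1
  have hm := hloc.aestronglyMeasurable
  have he : g' =ᵐ[volume] hm.mk g' := hm.ae_eq_mk
  have heP : (fun x => g' x ^ 2) =ᵐ[P] fun x => hm.mk g' x ^ 2 := by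
    filter_upwards [hac.ae_le he] with x hx
    rw [hx]
  rw [integral_congr_ae heP]
  refine ch_main P hP' g (hm.mk g') hm.stronglyMeasurable_mk.measurable (fun a b => ⟨?_, ?_⟩)
    (hint.congr heP)
  · exact (hAC a b).1.congr_ae (ae_restrict_of_ae he)
  · rw [(hAC a b).2]
    refine intervalIntegral.integral_congr_ae ?_
    filter_upwards [he] with x hx _
    exact hx

end
end
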